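/- There exists a constant c > 0 such that for all sufficiently large real x, the number of positive integers n ≤ x that can be written as n = 2^p + q with p a prime and q ∈ P₂ is at least c·x. In other words, the sumset 2^𝒫 + P₂ = {2^p + q : p prime, q ∈ P₂} has positive lower asymptotic density. -/

import Mathlib

open scoped Classical

/-- `P₂`: the set of positive integers that are a prime or a product of two primes
(not necessarily distinct). -/
def P2 (n : ℕ) : Prop := n.Prime ∨ ∃ p q : ℕ, p.Prime ∧ q.Prime ∧ n = p * q

namespace RomanovP2

open Finset

lemma sum_range_mul_of_coprime {a b : ℕ} (h : a.Coprime b) (ha : a ≠ 0) (hb : b ≠ 0)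
    (f g : ℕ → ℝ) :
    ∑ t ∈ range (a * b), f (t % a) * g (t % b) =
      (∑ t ∈ range a, f t) * ∑ t ∈ range b, g t := by
  rw [sum_mul_sum, ← sum_product']
  refine sum_nbij' (fun t => (t % a, t % b)) (fun x => (Nat.chineseRemainder h x.1 x.2 : ℕ))
    ?_ ?_ ?_ ?_ ?_
  · intro t _
    simp [Nat.mod_lt, Nat.pos_of_ne_zero ha, Nat.pos_of_ne_zero hb]
  · intro x _
    simpa using Nat.chineseRemainder_lt_mul h x.1 x.2 ha hb
  · intro t ht
    have h1 := (Nat.chineseRemainder h (t % a) (t % b)).2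
    have h2 : (Nat.chineseRemainder h (t % a) (t % b) : ℕ) ≡ t [MOD a * b] :=
      (Nat.modEq_and_modEq_iff_modEq_mul h).1
        ⟨h1.1.trans (Nat.mod_modEq t a), h1.2.trans (Nat.mod_modEq t b)⟩
    exact Nat.ModEq.eq_of_lt_of_lt h2 (Nat.chineseRemainder_lt_mul h _ _ ha hb)
      (mem_range.1 ht)
  · rintro ⟨x, y⟩ hx
    simp only [mem_product, mem_range] at hx
    have h1 := (Nat.chineseRemainder h x y).2
    ext
    · exact Nat.mod_eq_of_modEq h1.1 hx.1
    · exact Nat.mod_eq_of_modEq h1.2 hx.2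
  · intro t _
    rfl

lemma sum_range_prod_primes (g : ℕ → ℕ → ℝ) (V : Finset ℕ) (hV : ∀ p ∈ V, p.Prime) :
    ∑ t ∈ range (∏ p ∈ V, p), ∏ p ∈ V, g p (t % p) = ∏ p ∈ V, ∑ t ∈ range p, g p t := by
  induction V using Finset.induction_on with
  | empty => simp
  | insert q V hq ih =>
    have hqp := hV q (mem_insert_self q V)
    have hV' : ∀ p ∈ V, p.Prime := fun p hp => hV p (mem_insert_of_mem hp)
    have hne : ∏ p ∈ V, p ≠ 0 := prod_ne_zero_iff.2 fun p hp => (hV' p hp).ne_zero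
    have hcop : q.Coprime (∏ p ∈ V, p) := Nat.Coprime.prod_right fun p hp =>
      (Nat.coprime_primes hqp (hV' p hp)).2 (by rintro rfl; exact hq hp)
    rw [prod_insert hq, prod_insert hq, ← ih hV',
      ← sum_range_mul_of_coprime hcop hqp.ne_zero hne]
    refine sum_congr rfl fun t _ => ?_
    rw [prod_insert hq]
    congr 1
    exact prod_congr rfl fun p hp => by rw [Nat.mod_mod_of_dvd _ (dvd_prod_of_mem _ hp)]

lemma sum_range_periodic (G : ℕ → ℝ) (M : ℕ) (hG : ∀ t, G (t + M) = G t) (q r : ℕ) :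
    ∑ t ∈ range (M * q + r), G t = q * ∑ t ∈ range M, G t + ∑ t ∈ range r, G t := by
  induction q with
  | zero => simp
  | succ q ih =>
    rw [show M * (q + 1) + r = M + (M * q + r) by ring, sum_range_add]
    simp_rw [add_comm M, hG]
    rw [ih]
    push_cast
    ring

lemma sum_range_periodic_le (G : ℕ → ℝ) (M : ℕ) (hM : 0 < M) (hG : ∀ t, G (t + M) = G t)
    (hG1 : ∀ t, G t ≤ 1) {s : ℝ} (hs : 0 ≤ s) (hsum : ∑ t ∈ range M, G t = M * s) (N : ℕ) :
    ∑ t ∈ range N, G t ≤ N * s + M := by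
  have h := sum_range_periodic G M hG (N / M) (N % M)
  rw [Nat.div_add_mod, hsum] at h
  rw [h]
  have h1 : ∑ t ∈ range (N % M), G t ≤ M := by
    calc ∑ t ∈ range (N % M), G t ≤ ∑ t ∈ range (N % M), 1 := sum_le_sum fun t _ => hG1 t
      _ = ((N % M : ℕ) : ℝ) := by simp
      _ ≤ M := by exact_mod_cast (Nat.mod_lt N hM).le
  have h2 : ((N / M : ℕ) : ℝ) * (M * s) ≤ N * s := by
    rw [← mul_assoc]
    refine mul_le_mul_of_nonneg_right ?_ hs
    exact_mod_cast Nat.div_mul_le_self N M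
  linarith

/-- The Selberg density attached to a set `B` of forbidden residues modulo `p`. -/
noncomputable def sieveDensity (B : ℕ → Finset ℕ) (p : ℕ) : ℝ :=
  ((B p).card : ℝ) / (p - (B p).card)

/-- The mean-zero function modulo `p` that is constant on the allowed and on the forbidden
residues. -/
noncomputable def sieveFun (B : ℕ → Finset ℕ) (p t : ℕ) : ℝ :=
  if t % p ∈ B p then -1 else sieveDensity B p

variable {B : ℕ → Finset ℕ}

lemma sieveDensity_nonneg {p : ℕ} (h2 : 2 * (B p).card ≤ p) :
    0 ≤ sieveDensity B p := by
  have : (2 : ℝ) * (B p).card ≤ p := by exact_mod_cast h2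
  have h0 : (0 : ℝ) ≤ (B p).card := by positivity
  exact div_nonneg h0 (by linarith)

lemma sieveDensity_le_one {p : ℕ} (hp : p.Prime) (h2 : 2 * (B p).card ≤ p) :
    sieveDensity B p ≤ 1 := by
  have : (2 : ℝ) * (B p).card ≤ p := by exact_mod_cast h2
  have h0 : (0 : ℝ) < p := by exact_mod_cast hp.pos
  exact div_le_one_of_le₀ (by linarith) (by linarith)

lemma abs_sieveFun_le_one {p : ℕ} (hp : p.Prime) (h2 : 2 * (B p).card ≤ p) (t : ℕ) :
    |sieveFun B p t| ≤ 1 := by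
  unfold sieveFun
  split_ifs
  · simp
  · rw [abs_of_nonneg (sieveDensity_nonneg h2)]
    exact sieveDensity_le_one hp h2

lemma sieveFun_mod (p t : ℕ) : sieveFun B p (t % p) = sieveFun B p t := by
  simp [sieveFun]

lemma sum_range_sieve_ite {p : ℕ} (hB : B p ⊆ range p) (u v : ℝ) :
    ∑ t ∈ range p, (if t % p ∈ B p then u else v) =
      (B p).card * u + (p - (B p).card) * v := by
  have h : ∑ t ∈ range p, (if t % p ∈ B p then u else v) =
      ∑ t ∈ range p, (if t ∈ B p then u else v) :=
    sum_congr rfl fun t ht => by rw [Nat.mod_eq_of_lt (mem_range.1 ht)]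
  rw [h, sum_ite, sum_const, sum_const, filter_mem_eq_inter, inter_eq_right.2 hB,
    filter_notMem_eq_sdiff, card_sdiff_of_subset hB, card_range, nsmul_eq_mul, nsmul_eq_mul,
    Nat.cast_sub (by simpa using card_le_card hB)]

lemma sum_sieveFun {p : ℕ} (hp : p.Prime) (hB : B p ⊆ range p) (h2 : 2 * (B p).card ≤ p) :
    ∑ t ∈ range p, sieveFun B p t = 0 := by
  have : (2 : ℝ) * (B p).card ≤ p := by exact_mod_cast h2
  have h0 : (0 : ℝ) < p := by exact_mod_cast hp.pos
  have h1 : (p : ℝ) - (B p).card ≠ 0 := by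
    intro h; linarith
  unfold sieveFun
  rw [sum_range_sieve_ite hB, sieveDensity]
  field_simp
  ring

lemma sum_sieveFun_sq {p : ℕ} (hp : p.Prime) (hB : B p ⊆ range p)
    (h2 : 2 * (B p).card ≤ p) :
    ∑ t ∈ range p, sieveFun B p t * sieveFun B p t = p * sieveDensity B p := by
  have : (2 : ℝ) * (B p).card ≤ p := by exact_mod_cast h2
  have h0 : (0 : ℝ) < p := by exact_mod_cast hp.pos
  have h1 : (p : ℝ) - (B p).card ≠ 0 := by
    intro h; linarith
  have h3 : ∀ t, sieveFun B p t * sieveFun B p t =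
      if t % p ∈ B p then 1 else sieveDensity B p * sieveDensity B p := by
    intro t
    unfold sieveFun
    split_ifs <;> simp
  simp_rw [h3]
  rw [sum_range_sieve_ite hB, sieveDensity]
  field_simp
  ring

lemma prod_sieveFun_inter_union (T U : Finset ℕ) (t : ℕ) :
    (∏ p ∈ T, sieveFun B p t) * ∏ p ∈ U, sieveFun B p t =
      ∏ p ∈ T ∪ U, (if p ∈ T then sieveFun B p (t % p) else 1) *
        (if p ∈ U then sieveFun B p (t % p) else 1) := by
  rw [prod_mul_distrib]
  congr 1
  · rw [prod_ite_mem, inter_eq_right.2 subset_union_left]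
    simp_rw [sieveFun_mod]
  · rw [prod_ite_mem, inter_eq_right.2 subset_union_right]
    simp_rw [sieveFun_mod]

lemma sum_sieveFun_mul_le (hB : ∀ p, p.Prime → B p ⊆ range p)
    (h2 : ∀ p, p.Prime → 2 * (B p).card ≤ p) {T U : Finset ℕ}
    (hT : ∀ p ∈ T, p.Prime) (hU : ∀ p ∈ U, p.Prime) (N : ℕ) :
    ∑ t ∈ range N, (∏ p ∈ T, sieveFun B p t) * ∏ p ∈ U, sieveFun B p t ≤
      N * (if T = U then ∏ p ∈ T, sieveDensity B p else 0) +
        ((∏ p ∈ T, p) * ∏ p ∈ U, p : ℕ) := by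
  have hTU : ∀ p ∈ T ∪ U, p.Prime := fun p hp => (mem_union.1 hp).elim (hT p) (hU p)
  have hpos : 0 < ∏ p ∈ T ∪ U, p := prod_pos fun p hp => (hTU p hp).pos
  have hle : ∏ p ∈ T ∪ U, p ≤ (∏ p ∈ T, p) * ∏ p ∈ U, p := by
    rw [← prod_union_inter]
    exact Nat.le_mul_of_pos_right _ (prod_pos fun p hp => (hT p (mem_inter.1 hp).1).pos)
  have habs : ∀ V : Finset ℕ, (∀ p ∈ V, p.Prime) → ∀ t, |∏ p ∈ V, sieveFun B p t| ≤ 1 := by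
    intro V hV t
    rw [abs_prod]
    exact prod_le_one (fun _ _ => abs_nonneg _)
      fun p hp => abs_sieveFun_le_one (hV p hp) (h2 p (hV p hp)) t
  refine (sum_range_periodic_le _ (∏ p ∈ T ∪ U, p) hpos ?_ ?_ ?_ ?_ N).trans
    (add_le_add le_rfl (by exact_mod_cast hle))
  · intro t
    rw [prod_sieveFun_inter_union, prod_sieveFun_inter_union]
    refine prod_congr rfl fun p hp => ?_
    have : (t + ∏ p ∈ T ∪ U, p) % p = t % p := by
      rw [Nat.add_mod, Nat.mod_eq_zero_of_dvd (dvd_prod_of_mem _ hp)]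
      simp
    rw [this]
  · intro t
    refine (le_abs_self _).trans ?_
    rw [abs_mul]
    exact mul_le_one₀ (habs T hT t) (abs_nonneg _) (habs U hU t)
  · split_ifs
    · exact prod_nonneg fun p hp => sieveDensity_nonneg (h2 p (hT p hp))
    · exact le_rfl
  · simp_rw [prod_sieveFun_inter_union]
    rw [sum_range_prod_primes (fun p t => (if p ∈ T then sieveFun B p t else 1) *
        (if p ∈ U then sieveFun B p t else 1)) _ hTU]
    split_ifs with h
    · subst h
      rw [union_self, Nat.cast_prod, ← prod_mul_distrib]
      refine prod_congr rfl fun p hp => ?_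
      simp only [hp, if_true]
      exact sum_sieveFun_sq (hT p hp) (hB p (hT p hp)) (h2 p (hT p hp))
    · rw [mul_zero]
      obtain ⟨p, hp⟩ : ∃ p, ¬ (p ∈ T ↔ p ∈ U) := by
        by_contra! hcon
        exact h (Finset.ext hcon)
      have hpm : p ∈ T ∪ U := by rw [mem_union]; tauto
      refine prod_eq_zero hpm ?_
      have hz := sum_sieveFun (hTU p hpm) (hB p (hTU p hpm)) (h2 p (hTU p hpm))
      by_cases hpT : p ∈ T
      · have hpU : p ∉ U := by tauto
        simpa [hpT, hpU] using hz
      · have hpU : p ∈ U := by tauto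
        simpa [hpT, hpU] using hz

/-- The sets of primes whose product is at most `R`. -/
noncomputable def primeSets (R : ℕ) : Finset (Finset ℕ) :=
  (Icc 1 R).image Nat.primeFactors

lemma prime_of_mem_primeSets {R : ℕ} {T : Finset ℕ} (hT : T ∈ primeSets R) :
    ∀ p ∈ T, p.Prime := by
  obtain ⟨n, -, rfl⟩ := mem_image.1 hT
  exact fun p hp => Nat.prime_of_mem_primeFactors hp

lemma prod_le_of_mem_primeSets {R : ℕ} {T : Finset ℕ} (hT : T ∈ primeSets R) :
    ∏ p ∈ T, p ≤ R := by
  obtain ⟨n, hn, rfl⟩ := mem_image.1 hT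
  rw [mem_Icc] at hn
  exact (Nat.le_of_dvd (by omega) (Nat.prod_primeFactors_dvd n)).trans hn.2

lemma card_primeSets_le (R : ℕ) : (primeSets R).card ≤ R := by
  exact card_image_le.trans (by simp)

/-- **Selberg's sieve** in dual form. -/
theorem card_mul_sum_density_le (hB : ∀ p, p.Prime → B p ⊆ range p)
    (h2 : ∀ p, p.Prime → 2 * (B p).card ≤ p) {R N : ℕ} (hR : 1 ≤ R) {S : Finset ℕ}
    (hS : S ⊆ range N) (hSB : ∀ t ∈ S, ∀ p, p.Prime → p ≤ R → t % p ∉ B p) :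
    S.card * ∑ T ∈ primeSets R, ∏ p ∈ T, sieveDensity B p ≤ N + (R : ℝ) ^ 4 := by
  set H := ∑ T ∈ primeSets R, ∏ p ∈ T, sieveDensity B p with hH
  have hd : ∀ T ∈ primeSets R, 0 ≤ ∏ p ∈ T, sieveDensity B p := fun T hT =>
    prod_nonneg fun p hp => sieveDensity_nonneg
      (h2 p (prime_of_mem_primeSets hT p hp))
  have hH1 : 1 ≤ H := by
    have h0 : (∅ : Finset ℕ) ∈ primeSets R := mem_image.2 ⟨1, by simp [hR], by simp⟩
    simpa using single_le_sum hd h0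
  have hF : ∀ t ∈ S, ∑ T ∈ primeSets R, ∏ p ∈ T, sieveFun B p t = H := by
    intro t ht
    refine sum_congr rfl fun T hT => prod_congr rfl fun p hp => ?_
    have hp' := prime_of_mem_primeSets hT p hp
    have hpR : p ≤ R := (Nat.le_of_dvd
      (prod_pos fun q hq => (prime_of_mem_primeSets hT q hq).pos)
      (dvd_prod_of_mem _ hp)).trans (prod_le_of_mem_primeSets hT)
    simp [sieveFun, hSB t ht p hp' hpR]
  have h1 : S.card * H ^ 2 ≤ N * H + (R : ℝ) ^ 4 := by
    calc S.card * H ^ 2 = ∑ t ∈ S, (∑ T ∈ primeSets R, ∏ p ∈ T, sieveFun B p t) ^ 2 := by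
          rw [sum_congr rfl fun t ht => by rw [hF t ht], sum_const, nsmul_eq_mul]
      _ ≤ ∑ t ∈ range N, (∑ T ∈ primeSets R, ∏ p ∈ T, sieveFun B p t) ^ 2 :=
          sum_le_sum_of_subset_of_nonneg hS fun _ _ _ => sq_nonneg _
      _ = ∑ T ∈ primeSets R, ∑ U ∈ primeSets R, ∑ t ∈ range N,
            (∏ p ∈ T, sieveFun B p t) * ∏ p ∈ U, sieveFun B p t := by
          simp_rw [sq, sum_mul_sum]
          rw [sum_comm]
          exact sum_congr rfl fun T _ => sum_comm
      _ ≤ ∑ T ∈ primeSets R, ∑ U ∈ primeSets R,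
            (N * (if T = U then ∏ p ∈ T, sieveDensity B p else 0) + (R : ℝ) ^ 2) := by
          refine sum_le_sum fun T hT => sum_le_sum fun U hU => ?_
          refine (sum_sieveFun_mul_le hB h2 (prime_of_mem_primeSets hT)
            (prime_of_mem_primeSets hU) N).trans (add_le_add le_rfl ?_)
          rw [sq]
          exact_mod_cast Nat.mul_le_mul (prod_le_of_mem_primeSets hT)
            (prod_le_of_mem_primeSets hU)
      _ = N * H + ((primeSets R).card : ℝ) ^ 2 * (R : ℝ) ^ 2 := by
          simp_rw [sum_add_distrib, ← mul_sum, sum_ite_eq]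
          rw [hH, sum_congr rfl fun T hT => if_pos hT]
          simp
          ring
      _ ≤ N * H + (R : ℝ) ^ 4 := by
          have : ((primeSets R).card : ℝ) ≤ R := by exact_mod_cast card_primeSets_le R
          have h3 : ((primeSets R).card : ℝ) ^ 2 ≤ (R : ℝ) ^ 2 := by gcongr
          nlinarith [sq_nonneg (R : ℝ)]
  have hpos : 0 < H := by linarith
  have h4 : (S.card * H) * H ≤ (N + (R : ℝ) ^ 4) * H := by
    have : 0 ≤ (R : ℝ) ^ 4 := by positivity
    nlinarith
  exact le_of_mul_le_mul_right h4 hpos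

lemma sum_inv_coprime_ge (V : Finset ℕ) (hV : ∀ p ∈ V, p.Prime) (Y : ℕ) :
    (∏ p ∈ V, (1 - (p : ℝ)⁻¹)) * ∑ b ∈ Icc 1 Y, (b : ℝ)⁻¹ ≤
      ∑ b ∈ (Icc 1 Y).filter (fun b => ∀ p ∈ V, ¬ p ∣ b), (b : ℝ)⁻¹ := by
  induction V using Finset.induction_on with
  | empty => simp
  | insert q V hq ih =>
    have hqp := hV q (mem_insert_self q V)
    have ih := ih fun p hp => hV p (mem_insert_of_mem hp)
    set A := (Icc 1 Y).filter (fun b => ∀ p ∈ V, ¬ p ∣ b) with hA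
    have hins : (Icc 1 Y).filter (fun b => ∀ p ∈ insert q V, ¬ p ∣ b) =
        A.filter (fun b => ¬ q ∣ b) := by
      ext b
      simp only [hA, mem_filter, mem_insert, forall_eq_or_imp]
      tauto
    have hq0 : (0 : ℝ) < q := by exact_mod_cast hqp.pos
    have hdiv : ∑ b ∈ A.filter (fun b => q ∣ b), (b : ℝ)⁻¹ ≤
        (q : ℝ)⁻¹ * ∑ b ∈ A, (b : ℝ)⁻¹ := by
      have hinj : Set.InjOn (fun b => b / q) (A.filter (fun b => q ∣ b) : Set ℕ) := by
        intro a ha b hb hab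
        simp only [coe_filter, Set.mem_ofPred_eq] at ha hb
        have := congrArg (q * ·) hab
        simpa [Nat.mul_div_cancel' ha.2, Nat.mul_div_cancel' hb.2] using this
      rw [mul_sum]
      calc ∑ b ∈ A.filter (fun b => q ∣ b), (b : ℝ)⁻¹
          = ∑ b ∈ A.filter (fun b => q ∣ b), (q : ℝ)⁻¹ * ((b / q : ℕ) : ℝ)⁻¹ := by
            refine sum_congr rfl fun b hb => ?_
            rw [mem_filter] at hb
            obtain ⟨c, rfl⟩ := hb.2
            rw [Nat.mul_div_cancel_left _ hqp.pos]
            push_cast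
            rw [mul_inv]
        _ = ∑ c ∈ (A.filter (fun b => q ∣ b)).image (fun b => b / q),
              (q : ℝ)⁻¹ * (c : ℝ)⁻¹ := by
            rw [sum_image hinj]
        _ ≤ _ := by
            refine sum_le_sum_of_subset_of_nonneg ?_ fun _ _ _ => by positivity
            intro c hc
            obtain ⟨b, hb, rfl⟩ := mem_image.1 hc
            obtain ⟨hbA, k, rfl⟩ := mem_filter.1 hb
            rw [hA, mem_filter, mem_Icc] at hbA ⊢
            rw [Nat.mul_div_cancel_left _ hqp.pos]
            refine ⟨⟨?_, ?_⟩, fun p hp hd => hbA.2 p hp (hd.mul_left q)⟩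
            · rcases Nat.eq_zero_or_pos k with rfl | h
              · simp at hbA
              · exact h
            · exact (Nat.le_mul_of_pos_left k hqp.pos).trans hbA.1.2
    have hsplit := sum_filter_add_sum_filter_not A (fun b => q ∣ b) (fun b => (b : ℝ)⁻¹)
    rw [hins, prod_insert hq, mul_assoc]
    have h1 : (0 : ℝ) ≤ 1 - (q : ℝ)⁻¹ := by
      have : (q : ℝ)⁻¹ ≤ 1 := inv_le_one_of_one_le₀ (by exact_mod_cast hqp.one_lt.le)
      linarith
    have h2 := mul_le_mul_of_nonneg_left ih h1
    linarith

/-- The number of residues removed modulo `p`: one if `p ∣ E`, two otherwise. -/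
def sieveDim (E p : ℕ) : ℕ := if p ∣ E then 1 else 2

/-- The completely multiplicative extension of `p ↦ sieveDim E p / p`. -/
noncomputable def sieveWeight (E : ℕ) : ℕ →* ℝ where
  toFun n := if n = 0 then 0 else (n.primeFactorsList.map fun p => (sieveDim E p : ℝ) / p).prod
  map_one' := by simp
  map_mul' m n := by
    rcases eq_or_ne m 0 with rfl | hm
    · simp
    rcases eq_or_ne n 0 with rfl | hn
    · simp
    rw [if_neg (mul_ne_zero hm hn), if_neg hm, if_neg hn,
      ((Nat.perm_primeFactorsList_mul hm hn).map _).prod_eq, List.map_append, List.prod_append]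

lemma sieveWeight_prime (E : ℕ) {p : ℕ} (hp : p.Prime) :
    sieveWeight E p = (sieveDim E p : ℝ) / p := by
  simp [sieveWeight, hp.ne_zero, Nat.primeFactorsList_prime hp]

lemma sieveWeight_nonneg (E n : ℕ) : 0 ≤ sieveWeight E n := by
  change 0 ≤ if n = 0 then (0 : ℝ) else _
  split_ifs
  · exact le_rfl
  · refine List.prod_nonneg fun a ha => ?_
    obtain ⟨p, -, rfl⟩ := List.mem_map.1 ha
    positivity

lemma card_coprime_divisors_le (E n : ℕ) :
    ((n.divisors.filter fun b => b.Coprime E).card : ℝ) ≤ n * sieveWeight E n := by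
  induction n using induction_on_primes with
  | zero => simp
  | one =>
    have := card_filter_le (Nat.divisors 1) (fun b => b.Coprime E)
    simp only [Nat.divisors_one, card_singleton] at this
    simpa using this
  | prime_mul p a hp ih =>
    have hp0 : (p : ℝ) ≠ 0 := by exact_mod_cast hp.ne_zero
    rcases eq_or_ne a 0 with rfl | ha
    · simp
    set D := a.divisors.filter fun b => b.Coprime E with hD
    have hrhs : ((p * a : ℕ) : ℝ) * sieveWeight E (p * a) =
        sieveDim E p * (a * sieveWeight E a) := by
      rw [map_mul, sieveWeight_prime E hp]
      push_cast
      field_simp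
    rw [hrhs]
    have hcase : ∀ b ∈ ((p * a).divisors.filter fun b => b.Coprime E),
        b ∈ D ∨ (¬ p ∣ E ∧ b ∈ D.image (p * ·)) := by
      intro b hb
      simp only [mem_filter, Nat.mem_divisors, hD, mem_image] at hb ⊢
      by_cases hpb : p ∣ b
      · right
        obtain ⟨c, rfl⟩ := hpb
        refine ⟨fun h => ?_, c, ⟨⟨(Nat.mul_dvd_mul_iff_left hp.pos).1 hb.1.1, ha⟩,
          hb.2.coprime_mul_left⟩, rfl⟩
        exact hp.one_lt.ne' (Nat.dvd_one.1 (hb.2 ▸ Nat.dvd_gcd (dvd_mul_right p c) h))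
      · left
        exact ⟨⟨((hp.coprime_iff_not_dvd.2 hpb).symm).dvd_of_dvd_mul_left hb.1.1, ha⟩, hb.2⟩
    have hcard : ((p * a).divisors.filter fun b => b.Coprime E).card ≤ sieveDim E p * D.card := by
      unfold sieveDim
      split_ifs with h
      · rw [one_mul]
        exact card_le_card fun b hb => (hcase b hb).resolve_right fun h' => h'.1 h
      · calc _ ≤ (D ∪ D.image (p * ·)).card :=
              card_le_card fun b hb => mem_union.2 ((hcase b hb).imp_right And.right)
          _ ≤ D.card + (D.image (p * ·)).card := card_union_le _ _
          _ ≤ D.card + D.card := add_le_add le_rfl card_image_le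
          _ = 2 * D.card := (two_mul _).symm
    calc (((p * a).divisors.filter fun b => b.Coprime E).card : ℝ)
        ≤ sieveDim E p * (D.card : ℝ) := by exact_mod_cast hcard
      _ ≤ _ := by gcongr

lemma sum_inv_mul_sum_inv_le (E Y : ℕ) :
    (∑ a ∈ Icc 1 Y, (a : ℝ)⁻¹) * ∑ b ∈ (Icc 1 Y).filter (fun b => b.Coprime E), (b : ℝ)⁻¹ ≤
      ∑ n ∈ Icc 1 (Y ^ 2), sieveWeight E n := by
  rw [sum_mul_sum, ← sum_product']
  have hmaps : ∀ x ∈ Icc 1 Y ×ˢ (Icc 1 Y).filter (fun b => b.Coprime E),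
      x.1 * x.2 ∈ Icc 1 (Y ^ 2) := by
    intro x hx
    simp only [mem_product, mem_filter, mem_Icc] at hx ⊢
    exact ⟨Nat.mul_pos hx.1.1 hx.2.1.1, by rw [sq]; exact Nat.mul_le_mul hx.1.2 hx.2.1.2⟩
  rw [← sum_fiberwise_of_maps_to hmaps]
  refine sum_le_sum fun n hn => ?_
  have hn0 : 0 < n := (mem_Icc.1 hn).1
  have hn' : (0 : ℝ) < n := by exact_mod_cast hn0
  set P := (Icc 1 Y ×ˢ (Icc 1 Y).filter (fun b => b.Coprime E)).filter
    (fun x => x.1 * x.2 = n) with hP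
  have hcard : P.card ≤ (n.divisors.filter fun b => b.Coprime E).card := by
    refine card_le_card_of_injOn Prod.snd ?_ ?_
    · intro x hx
      simp only [hP, coe_filter, mem_product, mem_filter, mem_Icc, Set.mem_ofPred_eq] at hx
      simp only [coe_filter, Nat.mem_divisors, Set.mem_ofPred_eq]
      exact ⟨⟨⟨x.1, by rw [← hx.2, mul_comm]⟩, hn0.ne'⟩, hx.1.2.2⟩
    · intro x hx y hy hxy
      simp only [hP, coe_filter, mem_product, mem_filter, mem_Icc, Set.mem_ofPred_eq] at hx hy
      have h1 : x.1 * y.2 = y.1 * y.2 := by rw [hy.2, ← hxy, hx.2]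
      exact Prod.ext (Nat.eq_of_mul_eq_mul_right hy.1.2.1.1 h1) hxy
  calc ∑ x ∈ P, (x.1 : ℝ)⁻¹ * (x.2 : ℝ)⁻¹ = ∑ x ∈ P, (n : ℝ)⁻¹ := by
        refine sum_congr rfl fun x hx => ?_
        rw [hP, mem_filter] at hx
        rw [← mul_inv, ← hx.2]
        push_cast
        rfl
    _ = P.card * (n : ℝ)⁻¹ := by rw [sum_const, nsmul_eq_mul]
    _ ≤ (n * sieveWeight E n) * (n : ℝ)⁻¹ := by
        gcongr
        exact (by exact_mod_cast hcard : (P.card : ℝ) ≤ _).trans (card_coprime_divisors_le E n)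
    _ = sieveWeight E n := by field_simp

lemma sieveWeight_prime_lt_one {E : ℕ} (hE : 2 ∣ E) {p : ℕ} (hp : p.Prime) :
    sieveWeight E p < 1 := by
  rw [sieveWeight_prime E hp, div_lt_one (by exact_mod_cast hp.pos)]
  unfold sieveDim
  have := hp.two_le
  split_ifs with h
  · exact_mod_cast hp.one_lt
  · have h2 : p ≠ 2 := by rintro rfl; exact h hE
    exact_mod_cast (by omega : 2 < p)

lemma sum_sieveWeight_fiber_le {E : ℕ} (hE : 2 ∣ E) (A T : Finset ℕ) (hT : ∀ p ∈ T, p.Prime)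
    (hA : ∀ n ∈ A, n ≠ 0 ∧ n.primeFactors = T) :
    ∑ n ∈ A, sieveWeight E n ≤ ∏ p ∈ T, sieveWeight E p / (1 - sieveWeight E p) := by
  set d := ∏ p ∈ T, p with hd
  have hdpos : 0 < d := prod_pos fun p hp => (hT p hp).pos
  have hdvd : ∀ n ∈ A, d ∣ n := fun n hn => by
    rw [hd, ← (hA n hn).2]
    exact Nat.prod_primeFactors_dvd n
  have hmem : ∀ m ∈ A.image (· / d), m ∈ Nat.factoredNumbers T := by
    intro m hm
    obtain ⟨n, hn, rfl⟩ := mem_image.1 hm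
    refine Nat.mem_factoredNumbers_of_dvd ?_ (Nat.div_dvd_of_dvd (hdvd n hn))
    exact Nat.mem_factoredNumbers_of_primeFactors_subset (hA n hn).1 (hA n hn).2.subset
  have hinj : Set.InjOn (· / d) (A : Set ℕ) := by
    intro a ha b hb hab
    have := congrArg (d * ·) hab
    simpa [Nat.mul_div_cancel' (hdvd a ha), Nat.mul_div_cancel' (hdvd b hb)] using this
  have hsum := (EulerProduct.summable_and_hasSum_factoredNumbers_prod_filter_prime_geometric
    (f := sieveWeight E) (fun {p} hp => by
      rw [Real.norm_of_nonneg (sieveWeight_nonneg E p)]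
      exact sieveWeight_prime_lt_one hE hp) T).2
  rw [filter_true_of_mem hT] at hsum
  have hle := sum_le_hasSum ((A.image (· / d)).subtype (· ∈ Nat.factoredNumbers T))
    (fun m _ => sieveWeight_nonneg E m) hsum
  rw [sum_subtype_of_mem (fun m => sieveWeight E m) hmem, sum_image hinj] at hle
  simp_rw [div_eq_mul_inv]
  rw [prod_mul_distrib]
  calc ∑ n ∈ A, sieveWeight E n
      = (∏ p ∈ T, sieveWeight E p) * ∑ n ∈ A, sieveWeight E (n / d) := by
        rw [mul_sum]
        refine sum_congr rfl fun n hn => ?_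
        rw [← map_prod, ← map_mul, Nat.mul_div_cancel' (hdvd n hn)]
    _ ≤ _ := mul_le_mul_of_nonneg_left hle (prod_nonneg fun p _ => sieveWeight_nonneg E p)

lemma sum_sieveWeight_le {E : ℕ} (hE : 2 ∣ E) (R : ℕ) :
    ∑ n ∈ Icc 1 R, sieveWeight E n ≤
      ∑ T ∈ primeSets R, ∏ p ∈ T, sieveWeight E p / (1 - sieveWeight E p) := by
  rw [← sum_fiberwise_of_maps_to
    (fun n hn => mem_image_of_mem Nat.primeFactors hn : ∀ n ∈ Icc 1 R, _ ∈ primeSets R)]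
  refine sum_le_sum fun T hT => sum_sieveWeight_fiber_le hE _ T (prime_of_mem_primeSets hT) ?_
  intro n hn
  rw [mem_filter, mem_Icc] at hn
  exact ⟨by omega, hn.2⟩

/-- The ratio `n / φ(n)`, as a product over the primes dividing `n`. -/
noncomputable def totientRatio (n : ℕ) : ℝ := ∏ p ∈ n.primeFactors, (1 - (p : ℝ)⁻¹)⁻¹

lemma one_sub_inv_pos {p : ℕ} (hp : p.Prime) : (0 : ℝ) < 1 - (p : ℝ)⁻¹ := by
  have : (p : ℝ)⁻¹ < 1 := inv_lt_one_of_one_lt₀ (by exact_mod_cast hp.one_lt)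
  linarith

lemma one_le_inv_one_sub_inv {p : ℕ} (hp : p.Prime) : (1 : ℝ) ≤ (1 - (p : ℝ)⁻¹)⁻¹ := by
  refine (one_le_inv₀ (one_sub_inv_pos hp)).2 ?_
  have : (0 : ℝ) ≤ (p : ℝ)⁻¹ := by positivity
  linarith

lemma totientRatio_pos (n : ℕ) : 0 < totientRatio n :=
  prod_pos fun _ hp => inv_pos.2 (one_sub_inv_pos (Nat.prime_of_mem_primeFactors hp))

lemma log_le_sum_inv (Y : ℕ) : Real.log Y ≤ ∑ a ∈ Icc 1 Y, (a : ℝ)⁻¹ := by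
  rcases Nat.eq_zero_or_pos Y with rfl | hY
  · simp
  have h := log_add_one_le_harmonic Y
  rw [harmonic_eq_sum_Icc] at h
  push_cast at h
  refine le_trans (Real.log_le_log (by exact_mod_cast hY) ?_) h
  simp

/-- An upper bound sieve of dimension two with a singular series. -/
theorem card_mul_log_sq_le {B : ℕ → Finset ℕ} {E : ℕ} (hE : 6 ∣ E) (hE0 : E ≠ 0)
    (hB : ∀ p, p.Prime → B p ⊆ range p) (hcard : ∀ p, p.Prime → (B p).card = sieveDim E p)
    {Y N : ℕ} (hY : 1 ≤ Y) {S : Finset ℕ} (hS : S ⊆ range N)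
    (hSB : ∀ t ∈ S, ∀ p, p.Prime → p ≤ Y ^ 2 → t % p ∉ B p) :
    S.card * Real.log Y ^ 2 ≤ (N + (Y : ℝ) ^ 8) * totientRatio E := by
  have h2E : 2 ∣ E := (by norm_num : 2 ∣ 6).trans hE
  have h3E : 3 ∣ E := (by norm_num : 3 ∣ 6).trans hE
  have h2 : ∀ p, p.Prime → 2 * (B p).card ≤ p := by
    intro p hp
    rw [hcard p hp]
    unfold sieveDim
    have := hp.two_le
    split_ifs with h
    · omega
    · have h2 : p ≠ 2 := by rintro rfl; exact h h2E
      have h3 : p ≠ 3 := by rintro rfl; exact h h3E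
      omega
  have hmain := card_mul_sum_density_le hB h2 (Nat.one_le_pow 2 Y hY) hS hSB
  have hdens : ∑ T ∈ primeSets (Y ^ 2), ∏ p ∈ T, sieveDensity B p =
      ∑ T ∈ primeSets (Y ^ 2), ∏ p ∈ T, sieveWeight E p / (1 - sieveWeight E p) := by
    refine sum_congr rfl fun T hT => prod_congr rfl fun p hp => ?_
    have hpp := prime_of_mem_primeSets hT p hp
    have hp0 : (p : ℝ) ≠ 0 := by exact_mod_cast hpp.ne_zero
    have h1 := sieveWeight_prime_lt_one h2E hpp
    rw [sieveWeight_prime E hpp, div_lt_one (by exact_mod_cast hpp.pos)] at h1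
    rw [sieveDensity, hcard p hpp, sieveWeight_prime E hpp]
    have h2 : (p : ℝ) - sieveDim E p ≠ 0 := by linarith
    field_simp
  have hlow : (totientRatio E)⁻¹ * Real.log Y ^ 2 ≤
      ∑ T ∈ primeSets (Y ^ 2), ∏ p ∈ T, sieveDensity B p := by
    rw [hdens]
    refine le_trans ?_ ((sum_inv_mul_sum_inv_le E Y).trans (sum_sieveWeight_le h2E _))
    have hcop := sum_inv_coprime_ge E.primeFactors
      (fun p hp => Nat.prime_of_mem_primeFactors hp) Y
    have hfil : (Icc 1 Y).filter (fun b => ∀ p ∈ E.primeFactors, ¬ p ∣ b) =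
        (Icc 1 Y).filter (fun b => b.Coprime E) := by
      refine filter_congr fun b hb => ?_
      constructor
      · intro h
        refine Nat.Coprime.symm (Nat.coprime_of_dvd fun p hp h1 h2 => ?_)
        exact h p (Nat.mem_primeFactors.2 ⟨hp, h1, hE0⟩) h2
      · intro h p hp hpb
        have hpp := Nat.prime_of_mem_primeFactors hp
        exact hpp.one_lt.ne' (Nat.dvd_one.1
          (h ▸ Nat.dvd_gcd hpb (Nat.dvd_of_mem_primeFactors hp)))
    rw [hfil] at hcop
    have hinv : ∏ p ∈ E.primeFactors, (1 - (p : ℝ)⁻¹) = (totientRatio E)⁻¹ := by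
      rw [totientRatio, prod_inv_distrib, inv_inv]
    rw [hinv] at hcop
    have hl := log_le_sum_inv Y
    have hl0 : 0 ≤ Real.log Y := Real.log_natCast_nonneg Y
    have hG : 0 ≤ (totientRatio E)⁻¹ := inv_nonneg.2 (totientRatio_pos E).le
    calc (totientRatio E)⁻¹ * Real.log Y ^ 2 = Real.log Y * ((totientRatio E)⁻¹ * Real.log Y) := by
          ring
      _ ≤ (∑ a ∈ Icc 1 Y, (a : ℝ)⁻¹) * ((totientRatio E)⁻¹ * ∑ a ∈ Icc 1 Y, (a : ℝ)⁻¹) := by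
          gcongr
      _ ≤ _ := by gcongr
  have hG := totientRatio_pos E
  have h3 := (mul_le_mul_of_nonneg_left hlow (Nat.cast_nonneg (α := ℝ) S.card)).trans hmain
  calc S.card * Real.log Y ^ 2
      = (S.card * ((totientRatio E)⁻¹ * Real.log Y ^ 2)) * totientRatio E := by
        field_simp
    _ ≤ _ := by
        refine mul_le_mul_of_nonneg_right (h3.trans ?_) hG.le
        push_cast
        apply le_of_eq; ring

lemma totientRatio_mul_le {m n : ℕ} (hm : m ≠ 0) (hn : n ≠ 0) :
    totientRatio (m * n) ≤ totientRatio m * totientRatio n := by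
  unfold totientRatio
  rw [Nat.primeFactors_mul hm hn, ← prod_union_inter]
  have h1 : (1 : ℝ) ≤ ∏ p ∈ m.primeFactors ∩ n.primeFactors, (1 - (p : ℝ)⁻¹)⁻¹ :=
    one_le_prod fun _ hp =>
      one_le_inv_one_sub_inv (Nat.prime_of_mem_primeFactors (mem_inter.1 hp).1)
  refine le_mul_of_one_le_right (prod_nonneg fun p hp => ?_) h1
  have hpp : p.Prime :=
    (mem_union.1 hp).elim Nat.prime_of_mem_primeFactors Nat.prime_of_mem_primeFactors
  exact (inv_pos.2 (one_sub_inv_pos hpp)).le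

lemma totientRatio_prime_le {p : ℕ} (hp : p.Prime) : totientRatio p ≤ 2 := by
  rw [totientRatio, hp.primeFactors, prod_singleton]
  have : (p : ℝ)⁻¹ ≤ 2⁻¹ := inv_anti₀ two_pos (by exact_mod_cast hp.two_le)
  rw [inv_le_comm₀ (one_sub_inv_pos hp) two_pos]
  linarith

lemma totientRatio_prime_mul_le {p n : ℕ} (hp : p.Prime) (hn : n ≠ 0) :
    totientRatio (p * n) ≤ 2 * totientRatio n :=
  (totientRatio_mul_le hp.ne_zero hn).trans
    (mul_le_mul_of_nonneg_right (totientRatio_prime_le hp) (totientRatio_pos n).le)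

lemma totientRatio_two_pow_mul_le (k : ℕ) {n : ℕ} (hn : n ≠ 0) :
    totientRatio (2 ^ k * n) ≤ 2 * totientRatio n := by
  rcases eq_or_ne k 0 with rfl | hk
  · have := totientRatio_pos n
    simp only [pow_zero, one_mul]
    linarith
  · have h : totientRatio (2 ^ k) ≤ 2 := by
      rw [totientRatio, Nat.primeFactors_prime_pow hk Nat.prime_two, ← Nat.prime_two.primeFactors]
      exact totientRatio_prime_le Nat.prime_two
    exact (totientRatio_mul_le (by positivity) hn).trans
      (mul_le_mul_of_nonneg_right h (totientRatio_pos n).le)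

lemma totientRatio_six_mul_le {n : ℕ} (hn : n ≠ 0) :
    totientRatio (6 * n) ≤ 4 * totientRatio n := by
  have h1 := totientRatio_prime_mul_le Nat.prime_two (mul_ne_zero three_ne_zero hn)
  have h2 := totientRatio_prime_mul_le Nat.prime_three hn
  rw [show 6 * n = 2 * (3 * n) by ring]
  linarith

/-- The residues `t` modulo `p` with `p ∣ a * t + b`. -/
def rootSet (a b p : ℕ) : Finset ℕ := (range p).filter fun t => p ∣ a * t + b

lemma mod_mem_rootSet {a b p : ℕ} (hp : p.Prime) (t : ℕ) :
    t % p ∈ rootSet a b p ↔ p ∣ a * t + b := by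
  simp only [rootSet, mem_filter, mem_range, Nat.mod_lt t hp.pos, true_and]
  have h : a * (t % p) + b ≡ a * t + b [MOD p] :=
    ((Nat.mod_modEq t p).mul_left a).add_right b
  exact h.dvd_iff dvd_rfl

lemma card_rootSet {a p : ℕ} (b : ℕ) (hp : p.Prime) (ha : ¬ p ∣ a) :
    (rootSet a b p).card = 1 := by
  have := Fact.mk hp
  have ha' : (a : ZMod p) ≠ 0 := fun h => ha ((ZMod.natCast_eq_zero_iff a p).1 h)
  refine card_eq_one.2 ⟨((-b / a : ZMod p)).val, ?_⟩
  ext t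
  simp only [rootSet, mem_filter, mem_range, mem_singleton]
  constructor
  · rintro ⟨ht, hd⟩
    rw [← ZMod.natCast_eq_zero_iff] at hd
    push_cast at hd
    have : (t : ZMod p) = -b / a := by
      rw [eq_div_iff ha']
      linear_combination hd
    rw [← this, ZMod.val_natCast_of_lt ht]
  · rintro rfl
    refine ⟨ZMod.val_lt _, ?_⟩
    rw [← ZMod.natCast_eq_zero_iff]
    push_cast
    rw [ZMod.natCast_zmod_val]
    field_simp
    ring

/-- An upper bound for the number of simultaneous prime values of two linear forms. -/
theorem card_linear_forms_le {a₁ b₁ a₂ b₂ E : ℕ} (hE : 6 ∣ E) (hE0 : E ≠ 0)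
    (hcop : a₁.Coprime a₂)
    (hgood : ∀ p, p.Prime → ¬ p ∣ E → ¬ p ∣ a₁ ∧ ¬ p ∣ a₂ ∧ ¬ a₁ * b₂ ≡ a₂ * b₁ [MOD p])
    {Y N : ℕ} (hY : 1 ≤ Y) {S : Finset ℕ} (hS : S ⊆ range N)
    (h₁ : ∀ t ∈ S, (a₁ * t + b₁).Prime ∧ Y ^ 2 < a₁ * t + b₁)
    (h₂ : ∀ t ∈ S, (a₂ * t + b₂).Prime ∧ Y ^ 2 < a₂ * t + b₂) :
    S.card * Real.log Y ^ 2 ≤ (N + (Y : ℝ) ^ 8) * totientRatio E := by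
  refine card_mul_log_sq_le (B := fun p => if p ∣ E then
    (if p ∣ a₁ then rootSet a₂ b₂ p else rootSet a₁ b₁ p) else
      rootSet a₁ b₁ p ∪ rootSet a₂ b₂ p) hE hE0 ?_ ?_ hY hS ?_
  · intro p _
    split_ifs
    · exact filter_subset _ _
    · exact filter_subset _ _
    · exact union_subset (filter_subset _ _) (filter_subset _ _)
  · intro p hp
    unfold sieveDim
    split_ifs with h h'
    · refine card_rootSet b₂ hp fun h2 => ?_
      exact hp.one_lt.ne' (Nat.dvd_one.1 (hcop ▸ Nat.dvd_gcd h' h2))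
    · exact card_rootSet b₁ hp h'
    · obtain ⟨g1, g2, g3⟩ := hgood p hp h
      rw [card_union_of_disjoint, card_rootSet b₁ hp g1, card_rootSet b₂ hp g2]
      refine disjoint_left.2 fun t ht1 ht2 => g3 ?_
      have e1 := (Nat.modEq_zero_iff_dvd.2 (mem_filter.1 ht1).2).mul_left a₂
      have e2 := (Nat.modEq_zero_iff_dvd.2 (mem_filter.1 ht2).2).mul_left a₁
      have e3 : a₁ * a₂ * t + a₁ * b₂ ≡ a₁ * a₂ * t + a₂ * b₁ [MOD p] := by
        calc a₁ * a₂ * t + a₁ * b₂ = a₁ * (a₂ * t + b₂) := by ring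
          _ ≡ a₁ * 0 [MOD p] := e2
          _ = a₂ * 0 := by ring
          _ ≡ a₂ * (a₁ * t + b₁) [MOD p] := e1.symm
          _ = a₁ * a₂ * t + a₂ * b₁ := by ring
      exact Nat.ModEq.add_left_cancel' _ e3
  · intro t ht p hp hpY
    have n1 : t % p ∉ rootSet a₁ b₁ p := by
      rw [mod_mem_rootSet hp]
      intro hd
      have := (Nat.prime_dvd_prime_iff_eq hp (h₁ t ht).1).1 hd
      have := (h₁ t ht).2
      omega
    have n2 : t % p ∉ rootSet a₂ b₂ p := by
      rw [mod_mem_rootSet hp]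
      intro hd
      have := (Nat.prime_dvd_prime_iff_eq hp (h₂ t ht).1).1 hd
      have := (h₂ t ht).2
      omega
    split_ifs
    · exact n2
    · exact n1
    · rw [mem_union]
      tauto

/-- Prime pairs with a given difference. -/
theorem card_prime_pairs_le {m : ℕ} (hm : m ≠ 0) {Y N : ℕ} (hY : 1 ≤ Y) {S : Finset ℕ}
    (hS : S ⊆ range N) (h₁ : ∀ s ∈ S, s.Prime ∧ Y ^ 2 < s) (h₂ : ∀ s ∈ S, (s + m).Prime) :
    S.card * Real.log Y ^ 2 ≤ 4 * (N + (Y : ℝ) ^ 8) * totientRatio m := by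
  have h := card_linear_forms_le (a₁ := 1) (b₁ := 0) (a₂ := 1) (b₂ := m) (E := 6 * m)
    (dvd_mul_right 6 m) (by omega) (by simp) ?_ hY hS (fun s hs => by simpa using h₁ s hs)
    (fun s hs => ⟨by simpa using h₂ s hs, by have := (h₁ s hs).2; omega⟩)
  · refine h.trans ?_
    have h6 := totientRatio_six_mul_le hm
    have : (0 : ℝ) ≤ N + (Y : ℝ) ^ 8 := by positivity
    nlinarith
  · intro p hp hpE
    refine ⟨hp.one_lt.ne' ∘ Nat.dvd_one.1, hp.one_lt.ne' ∘ Nat.dvd_one.1, fun hmod => hpE ?_⟩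
    rw [one_mul, mul_zero] at hmod
    exact ((Nat.modEq_zero_iff_dvd).1 hmod).mul_left 6

/-- Prime solutions of `r₂ * s₂ = r₁ * s₁ + h` with fixed distinct primes `r₁` and `r₂`. -/
theorem card_prime_solutions_le {r₁ r₂ h : ℕ} (hr₁ : r₁.Prime) (hr₂ : r₂.Prime) (hne : r₁ ≠ r₂)
    (hh : h ≠ 0) {Y N : ℕ} (hY : 1 ≤ Y) {S : Finset ℕ} (hS : ∀ s ∈ S, s ≤ N)
    (h₁ : ∀ s ∈ S, s.Prime ∧ Y ^ 2 < s)
    (h₂ : ∀ s ∈ S, ∃ q, q.Prime ∧ Y ^ 2 < q ∧ r₂ * q = r₁ * s + h) :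
    S.card * Real.log Y ^ 2 ≤ 16 * (N / r₂ + 1 + (Y : ℝ) ^ 8) * totientRatio h := by
  have hG := totientRatio_pos h
  rcases S.eq_empty_or_nonempty with rfl | ⟨s₀, hs₀⟩
  · simp
    positivity
  have hcop : r₂.Coprime r₁ := (Nat.coprime_primes hr₂ hr₁).2 hne.symm
  obtain ⟨b, hb⟩ : ∃ b, b = s₀ % r₂ := ⟨_, rfl⟩
  have hmod : ∀ s ∈ S, s % r₂ = b := by
    intro s hs
    obtain ⟨q, -, -, hq⟩ := h₂ s hs
    obtain ⟨q₀, -, -, hq₀⟩ := h₂ s₀ hs₀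
    have e1 : r₁ * s + h ≡ r₁ * s₀ + h [MOD r₂] :=
      (Nat.modEq_zero_iff_dvd.2 ⟨q, hq.symm⟩).trans
        (Nat.modEq_zero_iff_dvd.2 ⟨q₀, hq₀.symm⟩).symm
    rw [hb]
    exact Nat.ModEq.cancel_left_of_coprime hcop (Nat.ModEq.add_right_cancel' h e1)
  obtain ⟨a, ha⟩ : ∃ a, r₂ * a = r₁ * b + h := by
    obtain ⟨q₀, -, -, hq₀⟩ := h₂ s₀ hs₀
    have e1 : r₁ * b + h ≡ r₁ * s₀ + h [MOD r₂] := by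
      rw [hb]
      exact ((Nat.mod_modEq s₀ r₂).mul_left r₁).add_right h
    obtain ⟨a, ha⟩ := (Nat.modEq_zero_iff_dvd).1
      (e1.trans (Nat.modEq_zero_iff_dvd.2 ⟨q₀, hq₀.symm⟩))
    exact ⟨a, ha.symm⟩
  have hsplit : ∀ s ∈ S, r₂ * (s / r₂) + b = s := fun s hs => by
    rw [← hmod s hs]
    exact Nat.div_add_mod s r₂
  have hinj : Set.InjOn (· / r₂) (S : Set ℕ) := by
    intro s hs s' hs' he
    rw [← hsplit s hs, ← hsplit s' hs']
    simp only at he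
    rw [he]
  have key := card_linear_forms_le (a₁ := r₂) (b₁ := b) (a₂ := r₁) (b₂ := a)
    (E := 6 * (r₁ * (r₂ * h))) (dvd_mul_right 6 _)
    (by simp [hr₁.ne_zero, hr₂.ne_zero, hh]) hcop ?_ hY (N := N / r₂ + 1)
    (S := S.image (· / r₂)) ?_ ?_ ?_
  · rw [card_image_of_injOn hinj] at key
    refine key.trans ?_
    have g1 := totientRatio_six_mul_le (n := r₁ * (r₂ * h))
      (by simp [hr₁.ne_zero, hr₂.ne_zero, hh])
    have g2 := totientRatio_prime_mul_le hr₁ (n := r₂ * h) (by simp [hr₂.ne_zero, hh])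
    have g3 := totientRatio_prime_mul_le hr₂ hh
    have g4 : totientRatio (6 * (r₁ * (r₂ * h))) ≤ 16 * totientRatio h := by linarith
    have g5 : ((N / r₂ + 1 : ℕ) : ℝ) ≤ N / r₂ + 1 := by
      push_cast
      exact add_le_add Nat.cast_div_le le_rfl
    calc (((N / r₂ + 1 : ℕ) : ℝ) + (Y : ℝ) ^ 8) * totientRatio (6 * (r₁ * (r₂ * h)))
        ≤ (N / r₂ + 1 + (Y : ℝ) ^ 8) * (16 * totientRatio h) := by
          gcongr
          exact (totientRatio_pos _).le
      _ = _ := by ring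
  · intro p hp hpE
    refine ⟨fun hd => hpE ?_, fun hd => hpE ?_, fun hd => hpE ?_⟩
    · exact ((hd.mul_right h).mul_left r₁).mul_left 6
    · exact (hd.mul_right _).mul_left 6
    · rw [ha] at hd
      have e : h ≡ 0 [MOD p] := Nat.ModEq.add_left_cancel' (r₁ * b) (by simpa using hd)
      exact (((Nat.modEq_zero_iff_dvd.1 e).mul_left r₂).mul_left r₁).mul_left 6
  · intro t ht
    obtain ⟨s, hs, rfl⟩ := mem_image.1 ht
    rw [mem_range, Nat.lt_succ_iff]
    exact Nat.div_le_div_right (hS s hs)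
  · intro t ht
    obtain ⟨s, hs, rfl⟩ := mem_image.1 ht
    rw [hsplit s hs]
    exact h₁ s hs
  · intro t ht
    obtain ⟨s, hs, rfl⟩ := mem_image.1 ht
    obtain ⟨q, hq, hqY, he⟩ := h₂ s hs
    have : r₁ * (s / r₂) + a = q := by
      refine Nat.eq_of_mul_eq_mul_left hr₂.pos ?_
      rw [he, mul_add, ha]
      conv_rhs => rw [← hsplit s hs]
      ring
    rw [this]
    exact ⟨hq, hqY⟩

lemma inv_one_sub_le_exp {u : ℝ} (hu : 0 ≤ u) (hu2 : u ≤ 1 / 2) :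
    (1 - u)⁻¹ ≤ Real.exp (2 * u) := by
  rw [inv_le_iff_one_le_mul₀ (by linarith)]
  have h := Real.add_one_le_exp (2 * u)
  nlinarith

lemma inv_prime_le_half {p : ℕ} (hp : p.Prime) : (p : ℝ)⁻¹ ≤ 1 / 2 := by
  rw [one_div]
  exact inv_anti₀ two_pos (by exact_mod_cast hp.two_le)

lemma prod_inv_one_sub_inv_le_exp (V : Finset ℕ) (hV : ∀ p ∈ V, p.Prime) :
    ∏ p ∈ V, (1 - (p : ℝ)⁻¹)⁻¹ ≤ Real.exp (2 * ∑ p ∈ V, (p : ℝ)⁻¹) := by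
  rw [mul_sum, Real.exp_sum]
  exact prod_le_prod (fun p hp => (inv_pos.2 (one_sub_inv_pos (hV p hp))).le)
    fun p hp => inv_one_sub_le_exp (by positivity) (inv_prime_le_half (hV p hp))

lemma log_log_le_sum_inv_primes {z : ℕ} (hz : 2 ≤ z) :
    Real.log (Real.log z) ≤ 2 * ∑ p ∈ Nat.primesLE z, (p : ℝ)⁻¹ := by
  have hV : ∀ p ∈ Nat.primesLE z, p.Prime := fun p hp => Nat.prime_of_mem_primesLE hp
  have h := sum_inv_coprime_ge (Nat.primesLE z) hV z
  have hfil : (Icc 1 z).filter (fun b => ∀ p ∈ Nat.primesLE z, ¬ p ∣ b) = {1} := by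
    ext b
    simp only [mem_filter, mem_Icc, mem_singleton, Nat.mem_primesLE]
    constructor
    · rintro ⟨⟨hb1, hbz⟩, hb⟩
      by_contra hne
      obtain ⟨p, hp, hpb⟩ := Nat.exists_prime_and_dvd hne
      exact hb p ⟨(Nat.le_of_dvd hb1 hpb).trans hbz, hp⟩ hpb
    · rintro rfl
      exact ⟨⟨le_rfl, by omega⟩, fun p hp hd => hp.2.one_lt.ne' (Nat.dvd_one.1 hd)⟩
  rw [hfil, sum_singleton, Nat.cast_one, inv_one] at h
  have hpos : 0 < ∏ p ∈ Nat.primesLE z, (1 - (p : ℝ)⁻¹) :=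
    prod_pos fun p hp => one_sub_inv_pos (hV p hp)
  have h1 : Real.log z ≤ ∏ p ∈ Nat.primesLE z, (1 - (p : ℝ)⁻¹)⁻¹ := by
    rw [prod_inv_distrib]
    have := (mul_le_mul_of_nonneg_left (log_le_sum_inv z) hpos.le).trans h
    rw [← one_div, le_div_iff₀ hpos]
    linarith
  have h2 := h1.trans (prod_inv_one_sub_inv_le_exp _ hV)
  have h3 : 0 < Real.log z := Real.log_pos (by exact_mod_cast hz)
  calc Real.log (Real.log z) ≤ Real.log (Real.exp (2 * ∑ p ∈ Nat.primesLE z, (p : ℝ)⁻¹)) :=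
        Real.log_le_log h3 h2
    _ = _ := Real.log_exp _

lemma sum_inv_primes_eq (N : ℕ) :
    ∑ p ∈ Nat.primesLE N, (p : ℝ)⁻¹ = (Nat.primesLE N).card / (N + 1 : ℝ) +
      ∑ n ∈ Icc 1 N, ((Nat.primesLE n).card : ℝ) / (n * (n + 1)) := by
  induction N with
  | zero => simp
  | succ N ih =>
    rw [Nat.primesLE_succ, sum_Icc_succ_top (by omega), Nat.primesLE_succ]
    split_ifs with h
    · rw [sum_insert (Nat.notMem_primesLE N), ih, card_insert_of_notMem (Nat.notMem_primesLE N)]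
      push_cast
      field_simp
      ring
    · rw [ih]
      push_cast
      field_simp
      ring

lemma eventually_card_primesLE_le {ε : ℝ} (hε : 0 < ε) :
    ∀ᶠ n : ℕ in Filter.atTop, ((Nat.primesLE n).card : ℝ) ≤ ε * n := by
  have h1 := (Chebyshev.eventually_primeCounting_le one_pos)
  have h2 := tendsto_natCast_atTop_atTop.eventually h1
  have h3 : ∀ᶠ n : ℕ in Filter.atTop, (Real.log 4 + 1) / ε ≤ Real.log n :=
    (Real.tendsto_log_atTop.comp tendsto_natCast_atTop_atTop).eventually_ge_atTop _
  filter_upwards [h2, h3, Filter.eventually_ge_atTop 2] with n hn hl h2n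
  rw [Nat.floor_natCast] at hn
  rw [Nat.primesLE_card_eq_primeCounting]
  refine hn.trans ?_
  have hlog : 0 < Real.log n := Real.log_pos (by exact_mod_cast h2n)
  rw [div_le_iff₀ hε] at hl
  rw [div_le_iff₀ hlog]
  have : (0 : ℝ) ≤ n := by positivity
  nlinarith

lemma sum_inv_le_one_add_log (N : ℕ) : ∑ n ∈ Icc 1 N, (n : ℝ)⁻¹ ≤ 1 + Real.log N := by
  have h := harmonic_le_one_add_log N
  rw [harmonic_eq_sum_Icc] at h
  push_cast at h
  exact h

lemma exists_sum_inv_primes_le {ε : ℝ} (hε : 0 < ε) :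
    ∃ C : ℝ, ∀ N : ℕ, ∑ p ∈ Nat.primesLE N, (p : ℝ)⁻¹ ≤ C + ε * Real.log N := by
  obtain ⟨n₀, hn₀⟩ := Filter.eventually_atTop.1 (eventually_card_primesLE_le hε)
  refine ⟨1 + n₀ + ε, fun N => ?_⟩
  have hcard : ∀ n : ℕ, ((Nat.primesLE n).card : ℝ) ≤ n + 1 := by
    intro n
    have : (Nat.primesLE n).card ≤ n + 1 := by
      rw [Nat.primesLE_eq_filter_range]
      exact (card_filter_le _ _).trans (by simp)
    exact_mod_cast this
  have h1 : ((Nat.primesLE N).card : ℝ) / (N + 1 : ℝ) ≤ 1 :=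
    div_le_one_of_le₀ (hcard N) (by positivity)
  have h2 : ∑ n ∈ Icc 1 N, ((Nat.primesLE n).card : ℝ) / (n * (n + 1)) ≤
      ∑ n ∈ Icc 1 N, ((if n < n₀ then 1 else 0) + ε * (n : ℝ)⁻¹) := by
    refine sum_le_sum fun n hn => ?_
    have hn1 : (0 : ℝ) < n := by exact_mod_cast (mem_Icc.1 hn).1
    have hn2 : (1 : ℝ) ≤ n := by exact_mod_cast (mem_Icc.1 hn).1
    split_ifs with h
    · have : ((Nat.primesLE n).card : ℝ) / (n * (n + 1)) ≤ 1 := by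
        refine div_le_one_of_le₀ ((hcard n).trans ?_) (by positivity)
        nlinarith
      have : 0 ≤ ε * (n : ℝ)⁻¹ := by positivity
      linarith
    · rw [zero_add, div_le_iff₀ (by positivity)]
      refine (hn₀ n (not_lt.1 h)).trans ?_
      field_simp
      nlinarith
  have h3 : ∑ n ∈ Icc 1 N, (if n < n₀ then (1 : ℝ) else 0) ≤ n₀ := by
    rw [sum_boole]
    have : ((Icc 1 N).filter fun n => n < n₀).card ≤ n₀ := by
      calc _ ≤ (range n₀).card := card_le_card fun n hn => by
            rw [mem_filter] at hn
            exact mem_range.2 hn.2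
        _ = n₀ := card_range _
    exact_mod_cast this
  rw [sum_inv_primes_eq]
  rw [sum_add_distrib, ← mul_sum] at h2
  have h4 := mul_le_mul_of_nonneg_left (sum_inv_le_one_add_log N) hε.le
  linarith

lemma totientRatio_le_of_card_le {n z : ℕ} (hz : 1 ≤ z) (h : n.primeFactors.card ≤ z) :
    totientRatio n ≤ Real.exp (1 + 2 * ∑ p ∈ Nat.primesLE z, (p : ℝ)⁻¹) := by
  have hz' : (0 : ℝ) < z := by exact_mod_cast hz
  have hpr : ∀ p ∈ n.primeFactors, p.Prime := fun p hp => Nat.prime_of_mem_primeFactors hp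
  unfold totientRatio
  rw [← prod_filter_mul_prod_filter_not n.primeFactors (fun p => p ≤ z), Real.exp_add, mul_comm]
  have h1 : ∏ p ∈ n.primeFactors with p ≤ z, (1 - (p : ℝ)⁻¹)⁻¹ ≤
      Real.exp (2 * ∑ p ∈ Nat.primesLE z, (p : ℝ)⁻¹) := by
    refine le_trans ?_ (prod_inv_one_sub_inv_le_exp _ fun p hp => Nat.prime_of_mem_primesLE hp)
    refine prod_le_prod_of_subset_of_one_le (fun p hp => ?_) (fun p hp => ?_) fun p hp _ => ?_
    · rw [mem_filter] at hp
      exact Nat.mem_primesLE.2 ⟨hp.2, hpr p hp.1⟩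
    · exact (inv_pos.2 (one_sub_inv_pos (hpr p (mem_filter.1 hp).1))).le
    · exact one_le_inv_one_sub_inv (Nat.prime_of_mem_primesLE hp)
  have h2 : ∏ p ∈ n.primeFactors with ¬ p ≤ z, (1 - (p : ℝ)⁻¹)⁻¹ ≤ Real.exp 1 := by
    calc ∏ p ∈ n.primeFactors with ¬ p ≤ z, (1 - (p : ℝ)⁻¹)⁻¹
        ≤ ∏ p ∈ n.primeFactors with ¬ p ≤ z, Real.exp (z : ℝ)⁻¹ := by
          refine prod_le_prod (fun p hp => ?_) fun p hp => ?_
          · exact (inv_pos.2 (one_sub_inv_pos (hpr p (mem_filter.1 hp).1))).le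
          · rw [mem_filter, not_le] at hp
            have hpz : (z : ℝ) + 1 ≤ p := by exact_mod_cast hp.2
            rw [inv_le_iff_one_le_mul₀ (one_sub_inv_pos (hpr p hp.1))]
            have e := Real.add_one_le_exp (z : ℝ)⁻¹
            have e2 : (p : ℝ)⁻¹ ≤ ((z : ℝ) + 1)⁻¹ := inv_anti₀ (by positivity) hpz
            have e3 : ((z : ℝ)⁻¹ + 1) * (1 - ((z : ℝ) + 1)⁻¹) = 1 := by
              field_simp
              ring
            calc (1 : ℝ) = ((z : ℝ)⁻¹ + 1) * (1 - ((z : ℝ) + 1)⁻¹) := e3.symm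
              _ ≤ ((z : ℝ)⁻¹ + 1) * (1 - (p : ℝ)⁻¹) := by gcongr
              _ ≤ _ := mul_le_mul_of_nonneg_right e (one_sub_inv_pos (hpr p hp.1)).le
      _ = Real.exp ((n.primeFactors.filter fun p => ¬ p ≤ z).card * (z : ℝ)⁻¹) := by
          rw [prod_const, Real.exp_nat_mul]
      _ ≤ Real.exp 1 := by
          refine Real.exp_le_exp.2 ?_
          rw [← div_eq_mul_inv]
          refine div_le_one_of_le₀ ?_ hz'.le
          exact_mod_cast (card_filter_le _ _).trans h
  exact mul_le_mul h2 h1 (prod_nonneg fun p hp =>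
    (inv_pos.2 (one_sub_inv_pos (hpr p (mem_filter.1 hp).1))).le) (Real.exp_pos _).le

lemma card_primeFactors_le_of_le_two_pow {n k : ℕ} (hn : n ≠ 0) (h : n ≤ 2 ^ k) :
    n.primeFactors.card ≤ k := by
  refine (Nat.pow_le_pow_iff_right (a := 2) one_lt_two).1 (le_trans ?_ h)
  calc 2 ^ n.primeFactors.card ≤ ∏ p ∈ n.primeFactors, p :=
        pow_card_le_prod _ _ _ fun p hp => (Nat.prime_of_mem_primeFactors hp).two_le
    _ ≤ n := Nat.le_of_dvd (Nat.pos_of_ne_zero hn) (Nat.prod_primeFactors_dvd n)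

/-- The product of the Mersenne numbers `2 ^ j - 1` with `1 ≤ j ≤ k`. -/
def mersenneProd (k : ℕ) : ℕ := ∏ j ∈ Icc 1 k, (2 ^ j - 1)

lemma two_pow_sub_one_ne_zero {j : ℕ} (hj : 1 ≤ j) : 2 ^ j - 1 ≠ 0 := by
  have : 2 ^ 1 ≤ 2 ^ j := Nat.pow_le_pow_right two_pos hj
  omega

lemma mersenneProd_ne_zero (k : ℕ) : mersenneProd k ≠ 0 :=
  prod_ne_zero_iff.2 fun _ hj => two_pow_sub_one_ne_zero (mem_Icc.1 hj).1

lemma mersenneProd_le (k : ℕ) : mersenneProd k ≤ 2 ^ k ^ 2 := by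
  calc mersenneProd k ≤ ∏ j ∈ Icc 1 k, 2 ^ k := prod_le_prod' fun j hj =>
        (Nat.sub_le _ _).trans (Nat.pow_le_pow_right two_pos (mem_Icc.1 hj).2)
    _ = 2 ^ k ^ 2 := by simp [← pow_mul, sq]

lemma exists_totientRatio_mersenneProd_sq_le :
    ∃ C : ℝ, 0 < C ∧ ∀ k : ℕ, 1 ≤ k →
      totientRatio (mersenneProd k) ^ 2 ≤ C * (k : ℝ) ^ (1 / 2 : ℝ) := by
  obtain ⟨C, hC⟩ := exists_sum_inv_primes_le (ε := 1 / 16) (by norm_num)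
  refine ⟨Real.exp (2 + 4 * C), Real.exp_pos _, fun k hk => ?_⟩
  have hk' : (0 : ℝ) < k := by exact_mod_cast hk
  have h1 := totientRatio_le_of_card_le (Nat.one_le_pow 2 k hk)
    (card_primeFactors_le_of_le_two_pow (mersenneProd_ne_zero k) (mersenneProd_le k))
  have h2 := hC (k ^ 2)
  have h3 : totientRatio (mersenneProd k) ^ 2 ≤
      Real.exp (1 + 2 * ∑ p ∈ Nat.primesLE (k ^ 2), (p : ℝ)⁻¹) ^ 2 :=
    pow_le_pow_left₀ (totientRatio_pos _).le h1 2
  refine h3.trans ?_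
  rw [Real.rpow_def_of_pos hk', ← Real.exp_add, ← Real.exp_nat_mul]
  refine Real.exp_le_exp.2 ?_
  push_cast at h2 ⊢
  rw [Real.log_pow] at h2
  push_cast at h2
  linarith

/-- The multiplicative weight whose sums over sets of prime factors give `totientRatio n ^ 2`. -/
noncomputable def sqWeight (p : ℕ) : ℝ := ((1 - (p : ℝ)⁻¹)⁻¹) ^ 2 - 1

lemma sqWeight_nonneg {p : ℕ} (hp : p.Prime) : 0 ≤ sqWeight p := by
  have := one_le_inv_one_sub_inv hp
  unfold sqWeight
  nlinarith

lemma sqWeight_le {p : ℕ} (hp : p.Prime) : sqWeight p ≤ 6 * (p : ℝ)⁻¹ := by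
  have h1 := inv_prime_le_half hp
  have h0 : (0 : ℝ) ≤ (p : ℝ)⁻¹ := by positivity
  unfold sqWeight
  generalize (p : ℝ)⁻¹ = u at *
  have h2 : 0 < 1 - u := by linarith
  rw [sub_le_iff_le_add, inv_pow, inv_le_iff_one_le_mul₀ (by positivity)]
  nlinarith [mul_nonneg h0 (mul_nonneg (sub_nonneg.2 h1) (by linarith : 0 ≤ 4 - 3 * u))]

lemma totientRatio_sq_eq_sum (n : ℕ) :
    totientRatio n ^ 2 = ∑ T ∈ n.primeFactors.powerset, ∏ p ∈ T, sqWeight p := by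
  rw [← prod_one_add, totientRatio, ← prod_pow]
  exact prod_congr rfl fun p _ => by rw [sqWeight]; ring

lemma sum_totientRatio_sq_eq (f : ℕ → ℕ) (M V : Finset ℕ)
    (hV : ∀ m ∈ M, (f m).primeFactors ⊆ V) :
    ∑ m ∈ M, totientRatio (f m) ^ 2 = ∑ T ∈ V.powerset,
      (∏ p ∈ T, sqWeight p) * ((M.filter fun m => T ⊆ (f m).primeFactors).card : ℝ) := by
  have h : ∀ m ∈ M, totientRatio (f m) ^ 2 =
      ∑ T ∈ V.powerset, if T ⊆ (f m).primeFactors then ∏ p ∈ T, sqWeight p else 0 := by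
    intro m hm
    rw [totientRatio_sq_eq_sum, ← sum_filter]
    refine sum_congr ?_ fun _ _ => rfl
    ext T
    simp only [mem_powerset, mem_filter]
    exact ⟨fun h => ⟨h.trans (hV m hm), h⟩, fun h => h.2⟩
  rw [sum_congr rfl h, sum_comm]
  refine sum_congr rfl fun T _ => ?_
  rw [← sum_filter, sum_const, nsmul_eq_mul, mul_comm]

theorem exists_sum_totientRatio_sq_le :
    ∃ C : ℝ, 0 < C ∧ ∀ K : ℕ, ∑ m ∈ Icc 1 K, totientRatio m ^ 2 ≤ C * K := by
  have hs : Summable fun n : ℕ => ((n : ℝ) ^ 2)⁻¹ := Real.summable_nat_pow_inv.2 one_lt_two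
  refine ⟨Real.exp (6 * ∑' n : ℕ, ((n : ℝ) ^ 2)⁻¹), Real.exp_pos _, fun K => ?_⟩
  have hprime : ∀ p ∈ Nat.primesLE K, p.Prime := fun p hp => (Nat.mem_primesLE.1 hp).2
  rw [sum_totientRatio_sq_eq (fun m => m) (Icc 1 K) (Nat.primesLE K)]
  · have hcard : ∀ T ∈ (Nat.primesLE K).powerset,
        (∏ p ∈ T, sqWeight p) * (((Icc 1 K).filter fun m => T ⊆ m.primeFactors).card : ℝ) ≤
        K * ∏ p ∈ T, sqWeight p * (p : ℝ)⁻¹ := by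
      intro T hT
      have hT' : ∀ p ∈ T, p.Prime := fun p hp => hprime p (mem_powerset.1 hT hp)
      have h1 : ((Icc 1 K).filter fun m => T ⊆ m.primeFactors).card ≤ K / ∏ p ∈ T, p := by
        rw [← Nat.Ioc_filter_dvd_card_eq_div]
        refine card_le_card fun m hm => ?_
        simp only [mem_filter, mem_Icc, mem_Ioc] at hm ⊢
        exact ⟨⟨by omega, hm.1.2⟩,
          (prod_dvd_prod_of_subset _ _ _ hm.2).trans (Nat.prod_primeFactors_dvd m)⟩
      have h2 : (((Icc 1 K).filter fun m => T ⊆ m.primeFactors).card : ℝ) ≤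
          K * ∏ p ∈ T, (p : ℝ)⁻¹ := by
        refine (Nat.cast_le.2 h1).trans (Nat.cast_div_le.trans ?_)
        rw [Nat.cast_prod, prod_inv_distrib, div_eq_mul_inv]
      calc _ ≤ (∏ p ∈ T, sqWeight p) * (K * ∏ p ∈ T, (p : ℝ)⁻¹) :=
            mul_le_mul_of_nonneg_left h2 (prod_nonneg fun p hp => sqWeight_nonneg (hT' p hp))
        _ = _ := by rw [prod_mul_distrib]; ring
    refine (sum_le_sum hcard).trans ?_
    rw [← mul_sum, ← prod_one_add, mul_comm]
    refine mul_le_mul_of_nonneg_right ?_ (Nat.cast_nonneg K)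
    calc ∏ p ∈ Nat.primesLE K, (1 + sqWeight p * (p : ℝ)⁻¹)
        ≤ ∏ p ∈ Nat.primesLE K, Real.exp (6 * ((p : ℝ) ^ 2)⁻¹) := by
          refine prod_le_prod (fun p hp => ?_) fun p hp => ?_
          · have := sqWeight_nonneg (hprime p hp)
            positivity
          · have h1 := Real.add_one_le_exp (6 * ((p : ℝ) ^ 2)⁻¹)
            have h2 := mul_le_mul_of_nonneg_right (sqWeight_le (hprime p hp))
              (by positivity : (0 : ℝ) ≤ (p : ℝ)⁻¹)
            have h3 : 6 * (p : ℝ)⁻¹ * (p : ℝ)⁻¹ = 6 * ((p : ℝ) ^ 2)⁻¹ := by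
              rw [sq, mul_inv]; ring
            linarith
      _ ≤ _ := by
          rw [← Real.exp_sum, ← mul_sum]
          refine Real.exp_le_exp.2 (mul_le_mul_of_nonneg_left ?_ (by norm_num))
          exact hs.sum_le_tsum _ fun n _ => by positivity
  · intro m hm p hp
    rw [mem_Icc] at hm
    exact Nat.mem_primesLE.2 ⟨(Nat.le_of_mem_primeFactors hp).trans hm.2,
      Nat.prime_of_mem_primeFactors hp⟩

lemma sum_Ico_inv_mul_succ {a b : ℕ} (ha : 1 ≤ a) (hab : a ≤ b) :
    ∑ k ∈ Ico a b, ((k : ℝ) * (k + 1))⁻¹ = (a : ℝ)⁻¹ - (b : ℝ)⁻¹ := by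
  induction b, hab using Nat.le_induction with
  | base => simp
  | succ b hb ih =>
    rw [sum_Ico_succ_top hb, ih]
    have : (0 : ℝ) < b := by exact_mod_cast ha.trans hb
    push_cast
    field_simp
    ring

lemma primeFactors_two_pow_sub_one_subset {j k : ℕ} (hj : 1 ≤ j) (hjk : j ≤ k) :
    (2 ^ j - 1).primeFactors ⊆ (mersenneProd k).primeFactors :=
  Nat.primeFactors_mono (dvd_prod_of_mem _ (mem_Icc.2 ⟨hj, hjk⟩)) (mersenneProd_ne_zero k)

lemma card_filter_subset_primeFactors_le (K : ℕ) (T : Finset ℕ) :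
    (((Icc 1 K).filter fun m => T ⊆ (2 ^ m - 1).primeFactors).card : ℝ) ≤
      K * (∑ k ∈ Icc 1 K, if T ⊆ (mersenneProd k).primeFactors then
        ((k : ℝ) * (k + 1))⁻¹ else 0) +
      if T ⊆ (mersenneProd K).primeFactors then 1 else 0 := by
  set M := (Icc 1 K).filter fun m => T ⊆ (2 ^ m - 1).primeFactors with hM
  have hnn : (0 : ℝ) ≤ ∑ k ∈ Icc 1 K, if T ⊆ (mersenneProd k).primeFactors then
        ((k : ℝ) * (k + 1))⁻¹ else 0 :=
    sum_nonneg fun k _ => by split_ifs <;> positivity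
  rcases M.eq_empty_or_nonempty with h0 | hne
  · rw [h0, card_empty, Nat.cast_zero]
    have : (0 : ℝ) ≤ if T ⊆ (mersenneProd K).primeFactors then (1 : ℝ) else 0 := by
      split_ifs <;> norm_num
    exact add_nonneg (mul_nonneg (Nat.cast_nonneg K) hnn) this
  set a := M.min' hne
  have ha : a ∈ M := M.min'_mem hne
  have ha' := ha
  rw [hM, mem_filter, mem_Icc] at ha'
  obtain ⟨⟨ha1, haK⟩, haT⟩ := ha'
  have hdvd : ∀ m ∈ M, a ∣ m := by
    intro m hm
    have hm' := hm
    rw [hM, mem_filter, mem_Icc] at hm'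
    have hg1 : 1 ≤ a.gcd m := Nat.gcd_pos_of_pos_left _ ha1
    have hga : a.gcd m ≤ a := Nat.gcd_le_left _ ha1
    have hgM : a.gcd m ∈ M := by
      rw [hM, mem_filter, mem_Icc]
      refine ⟨⟨hg1, hga.trans haK⟩, fun p hp => ?_⟩
      have h1 := haT hp
      have h2 := hm'.2 hp
      rw [← Nat.pow_sub_one_gcd_pow_sub_one]
      rw [Nat.mem_primeFactors] at h1 h2 ⊢
      refine ⟨h1.1, Nat.dvd_gcd h1.2.1 h2.2.1, ?_⟩
      exact Nat.gcd_ne_zero_left h1.2.2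
    have := M.min'_le _ hgM
    rw [← le_antisymm hga this]
    exact Nat.gcd_dvd_right _ _
  have hcard : M.card ≤ K / a := by
    rw [← Nat.Ioc_filter_dvd_card_eq_div]
    refine card_le_card fun m hm => ?_
    have hm' := hm
    rw [hM, mem_filter, mem_Icc] at hm'
    exact mem_filter.2 ⟨mem_Ioc.2 ⟨by omega, hm'.1.2⟩, hdvd m hm⟩
  have hcard' : (M.card : ℝ) ≤ K * (a : ℝ)⁻¹ := by
    rw [← div_eq_mul_inv]
    exact (Nat.cast_le.2 hcard).trans Nat.cast_div_le
  have hsum : (a : ℝ)⁻¹ - ((K + 1 : ℕ) : ℝ)⁻¹ ≤ ∑ k ∈ Icc 1 K,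
      if T ⊆ (mersenneProd k).primeFactors then ((k : ℝ) * (k + 1))⁻¹ else 0 := by
    rw [← sum_Ico_inv_mul_succ ha1 (by omega : a ≤ K + 1)]
    calc _ ≤ ∑ k ∈ Ico a (K + 1), if T ⊆ (mersenneProd k).primeFactors then
          ((k : ℝ) * (k + 1))⁻¹ else 0 := by
          refine sum_le_sum fun k hk => ?_
          rw [mem_Ico] at hk
          rw [if_pos (haT.trans (primeFactors_two_pow_sub_one_subset ha1 hk.1))]
      _ ≤ _ := by
          refine sum_le_sum_of_subset_of_nonneg (fun k hk => ?_) fun k _ _ => by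
            split_ifs <;> positivity
          rw [mem_Ico] at hk
          rw [mem_Icc]
          omega
  rw [if_pos (haT.trans (primeFactors_two_pow_sub_one_subset ha1 haK))]
  have h1 : (K : ℝ) * ((K + 1 : ℕ) : ℝ)⁻¹ ≤ 1 := by
    push_cast
    rw [← div_eq_mul_inv, div_le_one (by positivity)]
    linarith
  nlinarith [mul_le_mul_of_nonneg_left hsum (Nat.cast_nonneg (α := ℝ) K)]

theorem exists_sum_totientRatio_two_pow_sub_one_sq_le :
    ∃ C : ℝ, 0 < C ∧ ∀ K : ℕ, ∑ m ∈ Icc 1 K, totientRatio (2 ^ m - 1) ^ 2 ≤ C * K := by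
  obtain ⟨C, hC0, hC⟩ := exists_totientRatio_mersenneProd_sq_le
  have hs : Summable fun n : ℕ => ((n : ℝ) ^ (3 / 2 : ℝ))⁻¹ :=
    Real.summable_nat_rpow_inv.2 (by norm_num)
  have hS0 : (0 : ℝ) ≤ ∑' n : ℕ, ((n : ℝ) ^ (3 / 2 : ℝ))⁻¹ := tsum_nonneg fun n => by positivity
  refine ⟨C * (∑' n : ℕ, ((n : ℝ) ^ (3 / 2 : ℝ))⁻¹ + 1), by positivity, fun K => ?_⟩
  rcases Nat.eq_zero_or_pos K with rfl | hK
  · simp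
  have hV : ∀ p ∈ (mersenneProd K).primeFactors, p.Prime := fun p hp =>
    Nat.prime_of_mem_primeFactors hp
  rw [sum_totientRatio_sq_eq (fun m => 2 ^ m - 1) (Icc 1 K) (mersenneProd K).primeFactors
    fun m hm => primeFactors_two_pow_sub_one_subset (mem_Icc.1 hm).1 (mem_Icc.1 hm).2]
  have hfilt : ∀ k ∈ Icc 1 K, ∀ c : ℝ, ∑ T ∈ (mersenneProd K).primeFactors.powerset,
      (∏ p ∈ T, sqWeight p) * (if T ⊆ (mersenneProd k).primeFactors then c else 0) =
      c * totientRatio (mersenneProd k) ^ 2 := by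
    intro k hk c
    rw [totientRatio_sq_eq_sum, mul_sum]
    simp only [mul_ite, mul_zero]
    rw [← sum_filter]
    refine sum_congr ?_ fun _ _ => mul_comm _ _
    ext T
    simp only [mem_filter, mem_powerset, and_iff_right_iff_imp]
    refine fun h => h.trans (Nat.primeFactors_mono ?_ (mersenneProd_ne_zero K))
    refine prod_dvd_prod_of_subset _ _ _ fun j hj => ?_
    rw [mem_Icc] at hj hk ⊢
    omega
  calc _ ≤ ∑ T ∈ (mersenneProd K).primeFactors.powerset, (∏ p ∈ T, sqWeight p) *
        (K * (∑ k ∈ Icc 1 K, if T ⊆ (mersenneProd k).primeFactors then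
          ((k : ℝ) * (k + 1))⁻¹ else 0) +
        if T ⊆ (mersenneProd K).primeFactors then 1 else 0) :=
        sum_le_sum fun T hT => mul_le_mul_of_nonneg_left (card_filter_subset_primeFactors_le K T)
          (prod_nonneg fun p hp => sqWeight_nonneg (hV p (mem_powerset.1 hT hp)))
    _ = K * ∑ k ∈ Icc 1 K, ((k : ℝ) * (k + 1))⁻¹ * totientRatio (mersenneProd k) ^ 2 +
        1 * totientRatio (mersenneProd K) ^ 2 := by
        rw [← hfilt K (mem_Icc.2 ⟨hK, le_rfl⟩) 1, ← sum_congr rfl fun k hk => hfilt k hk _,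
          sum_comm, mul_sum, ← sum_add_distrib]
        refine sum_congr rfl fun T _ => ?_
        rw [mul_add, ← mul_sum]
        ring
    _ ≤ K * ∑ k ∈ Icc 1 K, C * ((k : ℝ) ^ (3 / 2 : ℝ))⁻¹ + C * K := by
        refine add_le_add (mul_le_mul_of_nonneg_left (sum_le_sum fun k hk => ?_)
          (Nat.cast_nonneg K)) ?_
        · have hk1 : (1 : ℝ) ≤ k := by exact_mod_cast (mem_Icc.1 hk).1
          have hk0 : (0 : ℝ) < k := by linarith
          have h2 : ((k : ℝ) * (k + 1))⁻¹ ≤ ((k : ℝ) ^ (3 / 2 : ℝ))⁻¹ * ((k : ℝ) ^ (1 / 2 : ℝ))⁻¹ := by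
            rw [← mul_inv, ← Real.rpow_add hk0]
            refine inv_anti₀ (by positivity) ?_
            norm_num
            nlinarith
          have h3 : (0 : ℝ) < (k : ℝ) ^ (1 / 2 : ℝ) := by positivity
          calc _ ≤ (((k : ℝ) ^ (3 / 2 : ℝ))⁻¹ * ((k : ℝ) ^ (1 / 2 : ℝ))⁻¹) *
                (C * (k : ℝ) ^ (1 / 2 : ℝ)) :=
                mul_le_mul h2 (hC k (mem_Icc.1 hk).1) (by positivity) (by positivity)
            _ = _ := by field_simp
        · rw [one_mul]
          refine (hC K hK).trans (mul_le_mul_of_nonneg_left ?_ hC0.le)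
          have : (1 : ℝ) ≤ K := by exact_mod_cast hK
          calc (K : ℝ) ^ (1 / 2 : ℝ) ≤ (K : ℝ) ^ (1 : ℝ) :=
                Real.rpow_le_rpow_of_exponent_le this (by norm_num)
            _ = K := Real.rpow_one _
    _ ≤ _ := by
        rw [← mul_sum]
        have := hs.sum_le_tsum (Icc 1 K) fun n _ => by positivity
        have h2 := mul_le_mul_of_nonneg_left this
          (by positivity : (0 : ℝ) ≤ K * C)
        linarith

theorem exists_sum_totientRatio_mul_le :
    ∃ C : ℝ, 0 < C ∧ ∀ K : ℕ,
      ∑ m ∈ Icc 1 K, totientRatio m * totientRatio (2 ^ m - 1) ≤ C * K := by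
  obtain ⟨C₁, h₁, H₁⟩ := exists_sum_totientRatio_sq_le
  obtain ⟨C₂, h₂, H₂⟩ := exists_sum_totientRatio_two_pow_sub_one_sq_le
  refine ⟨C₁ + C₂, by positivity, fun K => ?_⟩
  calc _ ≤ ∑ m ∈ Icc 1 K, (totientRatio m ^ 2 + totientRatio (2 ^ m - 1) ^ 2) :=
        sum_le_sum fun m _ => by
          nlinarith [sq_nonneg (totientRatio m - totientRatio (2 ^ m - 1)),
            sq_nonneg (totientRatio m), sq_nonneg (totientRatio (2 ^ m - 1))]
    _ ≤ _ := by
        rw [sum_add_distrib]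
        linarith [H₁ K, H₂ K]

lemma totientRatio_le_of_dvd {m n : ℕ} (hn : n ≠ 0) (h : m ∣ n) :
    totientRatio m ≤ totientRatio n := by
  refine prod_le_prod_of_subset_of_one_le (Nat.primeFactors_mono h hn) (fun p hp => ?_)
    fun p hp _ => one_le_inv_one_sub_inv (Nat.prime_of_mem_primeFactors hp)
  exact (inv_pos.2 (one_sub_inv_pos (Nat.prime_of_mem_primeFactors hp))).le

/-- The primes in `(Y ^ 2, N]`. -/
def largePrimes (Y N : ℕ) : Finset ℕ := (Nat.primesLE N).filter fun s => Y ^ 2 < s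

lemma mem_largePrimes {Y N s : ℕ} : s ∈ largePrimes Y N ↔ (s ≤ N ∧ s.Prime) ∧ Y ^ 2 < s := by
  rw [largePrimes, mem_filter, Nat.mem_primesLE]

lemma exists_card_largePrimes_ge :
    ∃ Y₀ : ℕ, ∀ Y ≥ Y₀, ∀ n : ℕ, Y ^ 8 ≤ n → n ≤ Y ^ 16 →
      (n : ℝ) ≤ 64 * ((largePrimes Y n).card * Real.log Y) := by
  refine ⟨20, fun Y hY n h1 h2 => ?_⟩
  have hYr : (20 : ℝ) ≤ Y := by exact_mod_cast hY
  have h1r : (Y : ℝ) ^ 8 ≤ n := by exact_mod_cast h1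
  have h2r : (n : ℝ) ≤ (Y : ℝ) ^ 16 := by exact_mod_cast h2
  have hn : (Y : ℝ) ≤ n := (le_self_pow₀ (by linarith) (by norm_num)).trans h1r
  have hlogY : 0 < Real.log Y := Real.log_pos (by linarith)
  have hlogn : 0 < Real.log n := Real.log_pos (by linarith)
  have hlogn' : Real.log n ≤ 16 * Real.log Y := by
    have := Real.log_le_log (by linarith) h2r
    rwa [Real.log_pow] at this
  have hpi := Chebyshev.pi_ge n
  rw [div_le_iff₀ hlogn] at hpi
  have hlog2 := Real.log_two_gt_d9
  have hlogn1 : Real.log (n + 1) ≤ 0.19 * n := by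
    have ha := Real.log_le_sub_one_of_pos (x := (n + 1 : ℝ) / 16) (by positivity)
    rw [Real.log_div (by positivity) (by norm_num), show (16 : ℝ) = 2 ^ 4 by norm_num,
      Real.log_pow] at ha
    have := Real.log_two_lt_d9
    push_cast at ha
    linarith
  have hsub : Nat.primeCounting n ≤ (largePrimes Y n).card + Y ^ 2 := by
    rw [← Nat.primesLE_card_eq_primeCounting]
    calc (Nat.primesLE n).card ≤ (largePrimes Y n ∪ Icc 1 (Y ^ 2)).card := by
          refine card_le_card fun p hp => ?_
          have hp' := Nat.mem_primesLE.1 hp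
          rw [mem_union, mem_largePrimes, mem_Icc]
          have := hp'.2.one_lt
          by_cases hpY : Y ^ 2 < p
          · exact Or.inl ⟨hp', hpY⟩
          · exact Or.inr ⟨by omega, by omega⟩
      _ ≤ _ := by simpa using card_union_le (largePrimes Y n) (Icc 1 (Y ^ 2))
  have hsub' : (Nat.primeCounting n : ℝ) ≤ (largePrimes Y n).card + (Y : ℝ) ^ 2 := by
    exact_mod_cast hsub
  have hlogY' : Real.log Y ≤ Y := (Real.log_le_sub_one_of_pos (by linarith)).trans (by linarith)
  have h3 : (Nat.primeCounting n : ℝ) * Real.log n ≤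
      ((largePrimes Y n).card + (Y : ℝ) ^ 2) * (16 * Real.log Y) :=
    mul_le_mul hsub' hlogn' hlogn.le (by positivity)
  have h4 : (Y : ℝ) ^ 2 * (16 * Real.log Y) ≤ n / 4 := by
    calc (Y : ℝ) ^ 2 * (16 * Real.log Y) ≤ (Y : ℝ) ^ 2 * (16 * Y) := by gcongr
      _ = 64 * (Y : ℝ) ^ 3 / 4 := by ring
      _ ≤ (Y : ℝ) ^ 5 * (Y : ℝ) ^ 3 / 4 := by
          gcongr
          calc (64 : ℝ) ≤ 20 ^ 5 := by norm_num
            _ ≤ (Y : ℝ) ^ 5 := by gcongr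
      _ ≤ n / 4 := by rw [← pow_add]; gcongr
  have h5 : 0.5 * (n : ℝ) ≤ n * Real.log 2 - Real.log (n + 1) := by
    nlinarith
  linarith

/-- Pairs of a small prime `r ≤ Y` and a prime `s > Y ^ 2` with `2 * r * s ≤ Y ^ 16`. -/
def primePairs (Y : ℕ) : Finset (ℕ × ℕ) :=
  (Nat.primesLE Y ×ˢ Nat.primesLE (Y ^ 16)).filter fun d => Y ^ 2 < d.2 ∧ 2 * d.1 * d.2 ≤ Y ^ 16

lemma mem_primePairs {Y : ℕ} {d : ℕ × ℕ} : d ∈ primePairs Y ↔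
    (d.1 ≤ Y ∧ d.1.Prime) ∧ d.2.Prime ∧ Y ^ 2 < d.2 ∧ 2 * d.1 * d.2 ≤ Y ^ 16 := by
  rw [primePairs, mem_filter, mem_product, Nat.mem_primesLE, Nat.mem_primesLE]
  constructor
  · tauto
  · rintro ⟨h1, h2, h3, h4⟩
    refine ⟨⟨h1, ?_, h2⟩, h3, h4⟩
    have := h1.2.pos
    nlinarith

/-- The sum of the reciprocals of the primes up to `Y`. -/
noncomputable def primeRecipSum (Y : ℕ) : ℝ := ∑ p ∈ Nat.primesLE Y, (p : ℝ)⁻¹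

lemma half_le_primeRecipSum {Y : ℕ} (hY : 2 ≤ Y) : 1 / 2 ≤ primeRecipSum Y := by
  have := single_le_sum (f := fun p : ℕ => (p : ℝ)⁻¹) (fun p _ => by positivity)
    (Nat.mem_primesLE.2 ⟨hY, Nat.prime_two⟩)
  unfold primeRecipSum
  norm_num at this ⊢
  exact this

lemma exists_card_primePairs_ge :
    ∃ Y₀ : ℕ, ∀ Y ≥ Y₀,
      (Y : ℝ) ^ 16 * primeRecipSum Y ≤ 256 * ((primePairs Y).card * Real.log Y) := by
  obtain ⟨Y₀, h₀⟩ := exists_card_largePrimes_ge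
  refine ⟨max Y₀ 2, fun Y hY => ?_⟩
  have hY2 : 2 ≤ Y := (le_max_right _ _).trans hY
  have hY2r : (2 : ℝ) ≤ Y := by exact_mod_cast hY2
  have hcard : (primePairs Y).card =
      ∑ r ∈ Nat.primesLE Y, (largePrimes Y (Y ^ 16 / (2 * r))).card := by
    rw [← card_sigma]
    refine card_nbij' (fun d => ⟨d.1, d.2⟩) (fun d => (d.1, d.2)) ?_ ?_ ?_ ?_
    · intro d hd
      have := mem_primePairs.1 (mem_coe.1 hd)
      simp only [coe_sigma, Set.mem_sigma_iff, mem_coe, Nat.mem_primesLE, mem_largePrimes]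
      refine ⟨this.1, ⟨?_, this.2.1⟩, this.2.2.1⟩
      rw [Nat.le_div_iff_mul_le (by have := this.1.2.pos; omega)]
      linarith [this.2.2.2]
    · intro d hd
      simp only [coe_sigma, Set.mem_sigma_iff, mem_coe, Nat.mem_primesLE, mem_largePrimes] at hd
      rw [mem_coe, mem_primePairs]
      refine ⟨hd.1, hd.2.1.2, hd.2.2, ?_⟩
      have := hd.2.1.1
      rw [Nat.le_div_iff_mul_le (by have := hd.1.2.pos; omega)] at this
      linarith
    · intro d _; rfl
    · intro d _; rfl
  rw [hcard, primeRecipSum, Nat.cast_sum, sum_mul, mul_sum, mul_sum]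
  refine sum_le_sum fun r hr => ?_
  obtain ⟨hrY, hrp⟩ := Nat.mem_primesLE.1 hr
  have hr2 : 0 < 2 * r := by have := hrp.pos; omega
  have hrr : (0 : ℝ) < r := by exact_mod_cast hrp.pos
  have hrYr : (r : ℝ) ≤ Y := by exact_mod_cast hrY
  have hlow : Y ^ 8 ≤ Y ^ 16 / (2 * r) := by
    rw [Nat.le_div_iff_mul_le hr2]
    calc Y ^ 8 * (2 * r) ≤ Y ^ 8 * (Y * Y) := by gcongr
      _ = Y ^ 10 := by ring
      _ ≤ Y ^ 16 := Nat.pow_le_pow_right (by omega) (by norm_num)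
  have h1 := h₀ Y ((le_max_left _ _).trans hY) _ hlow (Nat.div_le_self _ _)
  have h2 : (Y : ℝ) ^ 16 * (r : ℝ)⁻¹ ≤ 4 * ((Y ^ 16 / (2 * r) : ℕ) : ℝ) := by
    have h3 : Y ^ 16 < (Y ^ 16 / (2 * r) + 1) * (2 * r) := by
      have := Nat.lt_div_mul_add (a := Y ^ 16) hr2
      linarith
    have h4 : 1 ≤ Y ^ 16 / (2 * r) := (Nat.one_le_pow 8 Y (by omega)).trans hlow
    rw [← div_eq_mul_inv, div_le_iff₀ hrr]
    have h5 : (Y : ℝ) ^ 16 ≤ ((Y ^ 16 / (2 * r) : ℕ) + 1) * (2 * r) := by exact_mod_cast h3.le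
    have h6 : (1 : ℝ) ≤ ((Y ^ 16 / (2 * r) : ℕ) : ℝ) := by exact_mod_cast h4
    nlinarith
  linarith

/-- Quadruples counted by `r₂ * s₂ = r₁ * s₁ + h`. -/
noncomputable def shiftedPairs (Y h : ℕ) : Finset ((ℕ × ℕ) × (ℕ × ℕ)) :=
  (primePairs Y ×ˢ primePairs Y).filter fun e => e.2.1 * e.2.2 = e.1.1 * e.1.2 + h

/-- The larger primes `s₁` occurring in `shiftedPairs Y h` for given smaller primes. -/
noncomputable def shiftedFiber (Y h r₁ r₂ : ℕ) : Finset ℕ :=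
  (largePrimes Y (Y ^ 16 / (2 * r₁))).filter fun s =>
    ∃ q, q.Prime ∧ Y ^ 2 < q ∧ r₂ * q = r₁ * s + h

lemma card_shiftedPairs_le (Y h : ℕ) : (shiftedPairs Y h).card ≤
    ∑ r₁ ∈ Nat.primesLE Y, ∑ r₂ ∈ Nat.primesLE Y, (shiftedFiber Y h r₁ r₂).card := by
  rw [← sum_product', ← card_sigma]
  refine card_le_card_of_injOn (fun e => ⟨(e.1.1, e.2.1), e.1.2⟩) ?_ ?_
  · intro e he
    rw [mem_coe, shiftedPairs, mem_filter, mem_product, mem_primePairs, mem_primePairs] at he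
    obtain ⟨⟨h1, h2⟩, h3⟩ := he
    simp only [coe_sigma, Set.mem_sigma_iff, mem_coe, mem_product, Nat.mem_primesLE,
      shiftedFiber, mem_filter, mem_largePrimes]
    refine ⟨⟨h1.1, h2.1⟩, ⟨⟨?_, h1.2.1⟩, h1.2.2.1⟩, e.2.2, h2.2.1, h2.2.2.1, h3⟩
    rw [Nat.le_div_iff_mul_le (by have := h1.1.2.pos; omega)]
    linarith [h1.2.2.2]
  · intro e he e' he' hee
    rw [mem_coe, shiftedPairs, mem_filter, mem_product, mem_primePairs, mem_primePairs] at he he'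
    obtain ⟨⟨r₁, s₁⟩, ⟨r₂, s₂⟩⟩ := e
    obtain ⟨⟨r₁', s₁'⟩, ⟨r₂', s₂'⟩⟩ := e'
    simp only [Sigma.mk.injEq, Prod.mk.injEq, heq_eq_eq] at hee
    obtain ⟨⟨rfl, rfl⟩, rfl⟩ := hee
    have h1 := he.2.trans he'.2.symm
    simp only at h1
    rw [Nat.eq_of_mul_eq_mul_left he.1.2.1.2.pos h1]

lemma card_shiftedFiber_le_of_ne {Y h r₁ r₂ : ℕ} (hh : h ≠ 0) (h₁ : r₁ ∈ Nat.primesLE Y)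
    (h₂ : r₂ ∈ Nat.primesLE Y) (hne : r₁ ≠ r₂) :
    (shiftedFiber Y h r₁ r₂).card * Real.log Y ^ 2 ≤
      40 * ((Y : ℝ) ^ 16 * ((r₁ : ℝ)⁻¹ * (r₂ : ℝ)⁻¹)) * totientRatio h := by
  obtain ⟨hY₁, hp₁⟩ := Nat.mem_primesLE.1 h₁
  obtain ⟨hY₂, hp₂⟩ := Nat.mem_primesLE.1 h₂
  have hY : 1 ≤ Y := hp₁.one_lt.le.trans hY₁
  have key := card_prime_solutions_le hp₁ hp₂ hne hh hY (N := Y ^ 16 / (2 * r₁))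
    (S := shiftedFiber Y h r₁ r₂)
    (fun s hs => (mem_largePrimes.1 (mem_filter.1 hs).1).1.1)
    (fun s hs => ⟨(mem_largePrimes.1 (mem_filter.1 hs).1).1.2,
      (mem_largePrimes.1 (mem_filter.1 hs).1).2⟩)
    (fun s hs => (mem_filter.1 hs).2)
  refine key.trans (mul_le_mul_of_nonneg_right ?_ (totientRatio_pos h).le)
  have hr₁ : (0 : ℝ) < r₁ := by exact_mod_cast hp₁.pos
  have hr₂ : (0 : ℝ) < r₂ := by exact_mod_cast hp₂.pos
  have hY₁r : (r₁ : ℝ) ≤ Y := by exact_mod_cast hY₁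
  have hY₂r : (r₂ : ℝ) ≤ Y := by exact_mod_cast hY₂
  have hYr : (1 : ℝ) ≤ Y := by exact_mod_cast hY
  have e1 : ((Y ^ 16 / (2 * r₁) : ℕ) : ℝ) / r₂ ≤
      (Y : ℝ) ^ 16 * ((r₁ : ℝ)⁻¹ * (r₂ : ℝ)⁻¹) / 2 := by
    have : ((Y ^ 16 / (2 * r₁) : ℕ) : ℝ) ≤ (Y : ℝ) ^ 16 / (2 * r₁) := by
      have := Nat.cast_div_le (α := ℝ) (m := Y ^ 16) (n := 2 * r₁)
      push_cast at this
      exact this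
    calc _ ≤ (Y : ℝ) ^ 16 / (2 * r₁) / r₂ := by gcongr
      _ = _ := by field_simp
  have e2 : (Y : ℝ) ^ 8 ≤ (Y : ℝ) ^ 16 * ((r₁ : ℝ)⁻¹ * (r₂ : ℝ)⁻¹) := by
    rw [← mul_inv, ← div_eq_mul_inv, le_div_iff₀ (by positivity)]
    calc (Y : ℝ) ^ 8 * (r₁ * r₂) ≤ (Y : ℝ) ^ 8 * (Y * Y) := by gcongr
      _ = (Y : ℝ) ^ 10 := by ring
      _ ≤ (Y : ℝ) ^ 16 := pow_le_pow_right₀ hYr (by norm_num)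
  have e3 : 1 ≤ (Y : ℝ) ^ 8 := one_le_pow₀ hYr
  linarith

lemma card_shiftedFiber_self_le {Y h r : ℕ} (hh : h ≠ 0) (hr : r ∈ Nat.primesLE Y) :
    (shiftedFiber Y h r r).card * Real.log Y ^ 2 ≤
      12 * ((Y : ℝ) ^ 16 * (r : ℝ)⁻¹) * totientRatio h := by
  obtain ⟨hrY, hp⟩ := Nat.mem_primesLE.1 hr
  have hY : 1 ≤ Y := hp.one_lt.le.trans hrY
  have hTR := totientRatio_pos h
  rcases (shiftedFiber Y h r r).eq_empty_or_nonempty with h0 | ⟨s₀, hs₀⟩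
  · rw [h0, card_empty, Nat.cast_zero, zero_mul]
    positivity
  obtain ⟨k, rfl⟩ : r ∣ h := by
    obtain ⟨q, -, -, hq⟩ := (mem_filter.1 hs₀).2
    exact (Nat.dvd_add_right (dvd_mul_right r s₀)).1 (hq ▸ dvd_mul_right r q)
  have hk : k ≠ 0 := right_ne_zero_of_mul hh
  have key := card_prime_pairs_le hk hY (N := Y ^ 16 / (2 * r) + 1)
    (S := shiftedFiber Y (r * k) r r)
    (fun s hs => mem_range.2 <|
      Nat.lt_succ_of_le (mem_largePrimes.1 (mem_filter.1 hs).1).1.1)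
    (fun s hs => ⟨(mem_largePrimes.1 (mem_filter.1 hs).1).1.2,
      (mem_largePrimes.1 (mem_filter.1 hs).1).2⟩)
    (fun s hs => by
      obtain ⟨q, hq, -, hqs⟩ := (mem_filter.1 hs).2
      rw [← mul_add] at hqs
      rwa [← Nat.eq_of_mul_eq_mul_left hp.pos hqs])
  refine key.trans (mul_le_mul ?_ (totientRatio_le_of_dvd hh (dvd_mul_left k r))
    (totientRatio_pos k).le (by positivity))
  have hr0 : (0 : ℝ) < r := by exact_mod_cast hp.pos
  have hrYr : (r : ℝ) ≤ Y := by exact_mod_cast hrY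
  have hYr : (1 : ℝ) ≤ Y := by exact_mod_cast hY
  have e1 : ((Y ^ 16 / (2 * r) : ℕ) : ℝ) ≤ (Y : ℝ) ^ 16 * (r : ℝ)⁻¹ / 2 := by
    have := Nat.cast_div_le (α := ℝ) (m := Y ^ 16) (n := 2 * r)
    push_cast at this
    refine this.trans (le_of_eq ?_)
    field_simp
  have e2 : (Y : ℝ) ^ 8 ≤ (Y : ℝ) ^ 16 * (r : ℝ)⁻¹ := by
    rw [← div_eq_mul_inv, le_div_iff₀ (by positivity)]
    calc (Y : ℝ) ^ 8 * r ≤ (Y : ℝ) ^ 8 * Y := by gcongr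
      _ = (Y : ℝ) ^ 9 := by ring
      _ ≤ (Y : ℝ) ^ 16 := pow_le_pow_right₀ hYr (by norm_num)
  have e3 : 1 ≤ (Y : ℝ) ^ 8 := one_le_pow₀ hYr
  push_cast at *
  linarith

lemma card_shiftedPairs_mul_log_sq_le {Y h : ℕ} (hY : 2 ≤ Y) (hh : h ≠ 0) :
    (shiftedPairs Y h).card * Real.log Y ^ 2 ≤
      64 * primeRecipSum Y ^ 2 * (Y : ℝ) ^ 16 * totientRatio h := by
  have hTR := totientRatio_pos h
  have hfib : ∀ r₁ ∈ Nat.primesLE Y, ∀ r₂ ∈ Nat.primesLE Y,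
      (shiftedFiber Y h r₁ r₂).card * Real.log Y ^ 2 ≤
      40 * ((Y : ℝ) ^ 16 * ((r₁ : ℝ)⁻¹ * (r₂ : ℝ)⁻¹)) * totientRatio h +
      if r₁ = r₂ then 12 * ((Y : ℝ) ^ 16 * (r₁ : ℝ)⁻¹) * totientRatio h else 0 := by
    intro r₁ h₁ r₂ h₂
    split_ifs with hr
    · subst hr
      have : 0 ≤ 40 * ((Y : ℝ) ^ 16 * ((r₁ : ℝ)⁻¹ * (r₁ : ℝ)⁻¹)) * totientRatio h := by positivity
      linarith [card_shiftedFiber_self_le hh h₁]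
    · rw [add_zero]
      exact card_shiftedFiber_le_of_ne hh h₁ h₂ hr
  have hρ := half_le_primeRecipSum hY
  calc ((shiftedPairs Y h).card : ℝ) * Real.log Y ^ 2
      ≤ (∑ r₁ ∈ Nat.primesLE Y, ∑ r₂ ∈ Nat.primesLE Y, ((shiftedFiber Y h r₁ r₂).card : ℝ)) *
          Real.log Y ^ 2 := by
        gcongr
        exact_mod_cast card_shiftedPairs_le Y h
    _ ≤ ∑ r₁ ∈ Nat.primesLE Y, ∑ r₂ ∈ Nat.primesLE Y,
        (40 * ((Y : ℝ) ^ 16 * ((r₁ : ℝ)⁻¹ * (r₂ : ℝ)⁻¹)) * totientRatio h +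
        if r₁ = r₂ then 12 * ((Y : ℝ) ^ 16 * (r₁ : ℝ)⁻¹) * totientRatio h else 0) := by
        rw [sum_mul]
        refine sum_le_sum fun r₁ h₁ => ?_
        rw [sum_mul]
        exact sum_le_sum fun r₂ h₂ => hfib r₁ h₁ r₂ h₂
    _ = (40 * primeRecipSum Y ^ 2 + 12 * primeRecipSum Y) * (Y : ℝ) ^ 16 * totientRatio h := by
        have e1 : ∑ r₁ ∈ Nat.primesLE Y, ∑ r₂ ∈ Nat.primesLE Y,
            40 * ((Y : ℝ) ^ 16 * ((r₁ : ℝ)⁻¹ * (r₂ : ℝ)⁻¹)) * totientRatio h =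
            40 * primeRecipSum Y ^ 2 * (Y : ℝ) ^ 16 * totientRatio h := by
          rw [primeRecipSum, sq, sum_mul_sum]
          simp only [sum_mul, mul_sum]
          refine sum_congr rfl fun _ _ => sum_congr rfl fun _ _ => by ring
        have e2 : ∑ r₁ ∈ Nat.primesLE Y, ∑ r₂ ∈ Nat.primesLE Y,
            (if r₁ = r₂ then 12 * ((Y : ℝ) ^ 16 * (r₁ : ℝ)⁻¹) * totientRatio h else 0) =
            12 * primeRecipSum Y * (Y : ℝ) ^ 16 * totientRatio h := by
          rw [primeRecipSum, mul_sum, sum_mul, sum_mul]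
          refine sum_congr rfl fun r hr => ?_
          rw [sum_ite_eq, if_pos hr]
          ring
        simp only [sum_add_distrib]
        rw [e1, e2]
        ring
    _ ≤ _ := by
        have : 40 * primeRecipSum Y ^ 2 + 12 * primeRecipSum Y ≤ 64 * primeRecipSum Y ^ 2 := by
          nlinarith
        gcongr

lemma card_sq_le_card_image_mul {α : Type*} (E : Finset α) (f : α → ℕ) :
    E.card ^ 2 ≤ (E.image f).card * ((E ×ˢ E).filter fun e => f e.1 = f e.2).card := by
  have h1 : ∑ n ∈ E.image f, (E.filter fun e => f e = n).card ^ 2 ≤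
      ((E ×ˢ E).filter fun e => f e.1 = f e.2).card := by
    rw [card_eq_sum_card_fiberwise (f := fun e => f e.1) (t := E.image f)]
    · refine sum_le_sum fun n _ => ?_
      rw [sq, ← card_product]
      refine card_le_card fun e he => ?_
      simp only [mem_product, mem_filter] at he ⊢
      exact ⟨⟨⟨he.1.1, he.2.1⟩, he.1.2.trans he.2.2.symm⟩, he.1.2⟩
    · intro e he
      simp only [mem_coe, mem_filter, mem_product] at he
      exact mem_coe.2 (mem_image_of_mem f he.1.1)
  calc E.card ^ 2 = (∑ n ∈ E.image f, (E.filter fun e => f e = n).card) ^ 2 := by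
        rw [← card_eq_sum_card_image]
    _ ≤ (E.image f).card * ∑ n ∈ E.image f, (E.filter fun e => f e = n).card ^ 2 :=
        sq_sum_le_card_mul_sum_sq
    _ ≤ _ := Nat.mul_le_mul_left _ h1

/-- The exponents `p` for which both `p` and `p + m` are primes in `(Z ^ 2, Z ^ 8]`. -/
noncomputable def gapSet (Z m : ℕ) : Finset ℕ :=
  (largePrimes Z (Z ^ 8)).filter fun p => p + m ∈ largePrimes Z (Z ^ 8)

lemma card_gapSet_le {Z m : ℕ} (hZ : 1 ≤ Z) (hm : m ≠ 0) :
    (gapSet Z m).card * Real.log Z ^ 2 ≤ 12 * (Z : ℝ) ^ 8 * totientRatio m := by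
  have key := card_prime_pairs_le hm hZ (N := Z ^ 8 + 1) (S := gapSet Z m)
    (fun s hs => mem_range.2 <|
      Nat.lt_succ_of_le (mem_largePrimes.1 (mem_filter.1 hs).1).1.1)
    (fun s hs => ⟨(mem_largePrimes.1 (mem_filter.1 hs).1).1.2,
      (mem_largePrimes.1 (mem_filter.1 hs).1).2⟩)
    (fun s hs => (mem_largePrimes.1 (mem_filter.1 hs).2).1.2)
  refine key.trans (mul_le_mul_of_nonneg_right ?_ (totientRatio_pos m).le)
  have : (1 : ℝ) ≤ (Z : ℝ) ^ 8 := one_le_pow₀ (by exact_mod_cast hZ)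
  push_cast
  linarith

/-- The triples `(p, r, s)` giving rise to the sums `2 ^ p + r * s`. -/
def triples (Z Y : ℕ) : Finset (ℕ × (ℕ × ℕ)) := largePrimes Z (Z ^ 8) ×ˢ primePairs Y

/-- The integer represented by a triple. -/
def tripleSum (e : ℕ × (ℕ × ℕ)) : ℕ := 2 ^ e.1 + e.2.1 * e.2.2

lemma eq_of_mem_primePairs {Y : ℕ} {d e : ℕ × ℕ} (hd : d ∈ primePairs Y) (he : e ∈ primePairs Y)
    (h : d.1 * d.2 = e.1 * e.2) : d = e := by
  rw [mem_primePairs] at hd he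
  have h1 : d.1 = e.1 := by
    have : d.1 ∣ e.1 * e.2 := ⟨d.2, h.symm⟩
    rcases (Nat.Prime.dvd_mul hd.1.2).1 this with h2 | h2
    · exact (Nat.prime_dvd_prime_iff_eq hd.1.2 he.1.2).1 h2
    · have h3 := (Nat.prime_dvd_prime_iff_eq hd.1.2 he.2.1).1 h2
      have := he.2.2.1
      nlinarith [hd.1.1, Nat.le_self_pow (n := 2) (by norm_num) Y]
  refine Prod.ext h1 ?_
  rw [h1] at h
  exact Nat.eq_of_mul_eq_mul_left he.1.2.pos h

lemma card_coincidences_gt_le (Z Y : ℕ) :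
    ((triples Z Y ×ˢ triples Z Y).filter fun e =>
      tripleSum e.1 = tripleSum e.2 ∧ e.2.1 < e.1.1).card ≤
    ∑ m ∈ Icc 1 (Z ^ 8), ∑ p ∈ gapSet Z m, (shiftedPairs Y (2 ^ p * (2 ^ m - 1))).card := by
  rw [sum_sigma', ← card_sigma]
  refine card_le_card_of_injOn (fun e => ⟨⟨e.1.1 - e.2.1, e.2.1⟩, (e.1.2, e.2.2)⟩) ?_ ?_
  · intro e he
    replace he := mem_filter.1 (mem_coe.1 he)
    simp only [mem_product, triples, tripleSum] at he
    obtain ⟨⟨⟨h1, h2⟩, h3, h4⟩, h5, h6⟩ := he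
    simp only [coe_sigma, Set.mem_sigma_iff, mem_coe, mem_Icc, gapSet, mem_filter,
      shiftedPairs, mem_product]
    have h7 : e.2.1 + (e.1.1 - e.2.1) = e.1.1 := by omega
    refine ⟨⟨⟨by omega, ?_⟩, h3, h7.symm ▸ h1⟩, ⟨h2, h4⟩, ?_⟩
    · have := (mem_largePrimes.1 h1).1.1
      omega
    · have h8 : 2 ^ e.1.1 = 2 ^ e.2.1 * (2 ^ (e.1.1 - e.2.1) - 1) + 2 ^ e.2.1 := by
        rw [← Nat.mul_add_one, Nat.sub_add_cancel Nat.one_le_two_pow, ← pow_add, h7]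
      omega
  · rintro ⟨⟨p, d⟩, q, f⟩ he ⟨⟨p', d'⟩, q', f'⟩ he' h
    simp only [mem_coe, mem_filter] at he he'
    simp only [Sigma.mk.injEq, Prod.mk.injEq, heq_eq_eq] at h
    obtain ⟨⟨h1, rfl⟩, rfl, rfl⟩ := h
    obtain rfl : p = p' := by omega
    rfl

lemma card_coincidences_le (Z Y : ℕ) :
    ((triples Z Y ×ˢ triples Z Y).filter fun e => tripleSum e.1 = tripleSum e.2).card ≤
    (triples Z Y).card + 2 * ∑ m ∈ Icc 1 (Z ^ 8), ∑ p ∈ gapSet Z m,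
      (shiftedPairs Y (2 ^ p * (2 ^ m - 1))).card := by
  set E := triples Z Y with hE
  set G := (E ×ˢ E).filter fun e => tripleSum e.1 = tripleSum e.2 ∧ e.2.1 < e.1.1 with hG
  have hsub : ((E ×ˢ E).filter fun e => tripleSum e.1 = tripleSum e.2) ⊆
      E.image (fun e => (e, e)) ∪ (G ∪ G.image Prod.swap) := by
    rintro ⟨⟨p, d⟩, q, f⟩ he
    rw [mem_filter, mem_product] at he
    obtain ⟨⟨h1, h2⟩, h3⟩ := he
    rw [mem_union, mem_union]
    rcases lt_trichotomy p q with h | rfl | h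
    · refine Or.inr (Or.inr (mem_image.2 ⟨((q, f), p, d), ?_, rfl⟩))
      exact mem_filter.2 ⟨mem_product.2 ⟨h2, h1⟩, h3.symm, h⟩
    · refine Or.inl (mem_image.2 ⟨(p, d), h1, ?_⟩)
      simp only [hE, triples, mem_product] at h1 h2
      simp only [tripleSum, Nat.add_left_cancel_iff] at h3
      rw [eq_of_mem_primePairs h1.2 h2.2 h3]
    · exact Or.inr (Or.inl (mem_filter.2 ⟨mem_product.2 ⟨h1, h2⟩, h3, h⟩))
  have h1 := card_coincidences_gt_le Z Y
  rw [← hE, ← hG] at h1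
  have h2 : (E.image fun e => (e, e)).card ≤ E.card := card_image_le
  have h3 : (G.image Prod.swap).card ≤ G.card := card_image_le
  have h4 := card_le_card hsub
  have h5 := card_union_le (E.image fun e => (e, e)) (G ∪ G.image Prod.swap)
  have h6 := card_union_le G (G.image Prod.swap)
  omega

lemma exists_sum_card_shiftedPairs_le :
    ∃ C : ℝ, 0 < C ∧ ∀ Z Y : ℕ, 1 ≤ Z → 2 ≤ Y →
      ((∑ m ∈ Icc 1 (Z ^ 8), ∑ p ∈ gapSet Z m, (shiftedPairs Y (2 ^ p * (2 ^ m - 1))).card : ℕ) : ℝ)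
        * (Real.log Y ^ 2 * Real.log Z ^ 2) ≤
      C * (((Z : ℝ) ^ 8) ^ 2 * primeRecipSum Y ^ 2 * (Y : ℝ) ^ 16) := by
  obtain ⟨C, hC0, hC⟩ := exists_sum_totientRatio_mul_le
  refine ⟨1536 * C, by positivity, fun Z Y hZ hY => ?_⟩
  set B := primeRecipSum Y ^ 2 * (Y : ℝ) ^ 16 with hB
  have hB0 : 0 ≤ B := by positivity
  have hinner : ∀ m ∈ Icc 1 (Z ^ 8),
      (∑ p ∈ gapSet Z m, ((shiftedPairs Y (2 ^ p * (2 ^ m - 1))).card : ℝ)) *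
        (Real.log Y ^ 2 * Real.log Z ^ 2) ≤
      1536 * B * (Z : ℝ) ^ 8 * (totientRatio m * totientRatio (2 ^ m - 1)) := by
    intro m hm
    have hm1 := (mem_Icc.1 hm).1
    have hm0 := two_pow_sub_one_ne_zero hm1
    have h1 : (∑ p ∈ gapSet Z m, ((shiftedPairs Y (2 ^ p * (2 ^ m - 1))).card : ℝ)) *
        Real.log Y ^ 2 ≤ (gapSet Z m).card * (128 * B * totientRatio (2 ^ m - 1)) := by
      rw [sum_mul, ← nsmul_eq_mul, ← sum_const]
      refine sum_le_sum fun p _ => ?_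
      refine (card_shiftedPairs_mul_log_sq_le hY (mul_ne_zero (by positivity) hm0)).trans ?_
      have := mul_le_mul_of_nonneg_left (totientRatio_two_pow_mul_le p hm0)
        (by positivity : 0 ≤ 64 * B)
      rw [hB] at this ⊢
      linarith
    have h2 := card_gapSet_le hZ (by omega : m ≠ 0)
    have h3 := (totientRatio_pos (2 ^ m - 1)).le
    calc _ = (∑ p ∈ gapSet Z m, ((shiftedPairs Y (2 ^ p * (2 ^ m - 1))).card : ℝ)) *
        Real.log Y ^ 2 * Real.log Z ^ 2 := by ring
      _ ≤ (gapSet Z m).card * (128 * B * totientRatio (2 ^ m - 1)) * Real.log Z ^ 2 := by gcongr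
      _ = ((gapSet Z m).card * Real.log Z ^ 2) * (128 * B * totientRatio (2 ^ m - 1)) := by ring
      _ ≤ (12 * (Z : ℝ) ^ 8 * totientRatio m) * (128 * B * totientRatio (2 ^ m - 1)) := by gcongr
      _ = _ := by ring
  push_cast
  rw [sum_mul]
  refine (sum_le_sum hinner).trans ?_
  rw [← mul_sum]
  have := mul_le_mul_of_nonneg_left (hC (Z ^ 8)) (by positivity : 0 ≤ 1536 * B * (Z : ℝ) ^ 8)
  push_cast at this
  refine this.trans (le_of_eq ?_)
  rw [hB]
  ring

/-- The integers up to `N` of the form `2 ^ p + q` with `p` prime and `q` in `P2`. -/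
noncomputable def sumset (N : ℕ) : Finset ℕ :=
  (Icc 1 N).filter fun n => ∃ p q : ℕ, p.Prime ∧ P2 q ∧ n = 2 ^ p + q

lemma image_tripleSum_subset {Z Y : ℕ} (hZ : 2 ^ Z ^ 8 ≤ Y) :
    (triples Z Y).image tripleSum ⊆ sumset (Y ^ 16) := by
  intro n hn
  obtain ⟨⟨p, r, s⟩, he, rfl⟩ := mem_image.1 hn
  rw [triples, mem_product, mem_largePrimes, mem_primePairs] at he
  obtain ⟨h1, h2⟩ := he
  simp only at h1 h2
  rw [sumset, mem_filter, mem_Icc]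
  have h3 : 2 ^ p ≤ Y := (Nat.pow_le_pow_right (by norm_num) h1.1.1).trans hZ
  have hY : 2 ≤ Y := (Nat.le_self_pow h1.1.2.ne_zero 2).trans h3
  have h4 : 2 * Y ≤ Y ^ 16 := by
    calc 2 * Y ≤ Y * Y := by gcongr
      _ = Y ^ 2 := (sq Y).symm
      _ ≤ Y ^ 16 := Nat.pow_le_pow_right (by omega) (by norm_num)
  have h5 : 0 < 2 ^ p := by positivity
  simp only [tripleSum]
  refine ⟨⟨by omega, ?_⟩, p, r * s, h1.1.2, Or.inr ⟨r, s, h2.1.2, h2.2.1, rfl⟩, rfl⟩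
  have := h2.2.2.2
  rw [mul_assoc] at this
  omega

theorem exists_card_sumset_pow_ge :
    ∃ c : ℝ, 0 < c ∧ ∃ Z₀ : ℕ, ∀ Z ≥ Z₀, ∀ Y : ℕ, 2 ^ Z ^ 8 ≤ Y → Y < 2 ^ (Z + 1) ^ 8 →
      c * (Y : ℝ) ^ 16 ≤ (sumset (Y ^ 16)).card := by
  obtain ⟨C, hC0, hC⟩ := exists_sum_card_shiftedPairs_le
  obtain ⟨Z₁, hZ₁⟩ := exists_card_largePrimes_ge
  obtain ⟨Y₁, hY₁⟩ := exists_card_primePairs_ge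
  refine ⟨(2 ^ 22 + 2 ^ 29 * C)⁻¹, by positivity, max (max Z₁ Y₁) 2, fun Z hZ Y hYl hYu => ?_⟩
  have hZ2 : 2 ≤ Z := (le_max_right _ _).trans hZ
  have hZZ₁ : Z₁ ≤ Z := (le_max_left _ _).trans ((le_max_left _ _).trans hZ)
  have hZY : Z ≤ Y := (Nat.lt_two_pow_self.le.trans
    (Nat.pow_le_pow_right (by norm_num) (Nat.le_self_pow (by norm_num) Z))).trans hYl
  have hYY₁ : Y₁ ≤ Y := (le_max_right _ _).trans ((le_max_left _ _).trans (hZ.trans hZY))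
  have hY2 : 2 ≤ Y := hZ2.trans hZY
  have hZr : (2 : ℝ) ≤ Z := by exact_mod_cast hZ2
  have hYr : (2 : ℝ) ≤ Y := by exact_mod_cast hY2
  set K : ℝ := (Z : ℝ) ^ 8 with hK
  set X : ℝ := (Y : ℝ) ^ 16 with hX
  set ρ := primeRecipSum Y with hρ
  set a : ℝ := ((largePrimes Z (Z ^ 8)).card : ℝ) with ha
  set d : ℝ := ((primePairs Y).card : ℝ) with hd
  set LZ := Real.log Z with hLZ
  set LY := Real.log Y with hLY
  have hLZ0 : 0 < LZ := Real.log_pos (by linarith)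
  have hLY0 : 0 < LY := Real.log_pos (by linarith)
  have hX0 : 0 < X := by positivity
  have hK0 : 0 < K := by positivity
  have hA : K ≤ 64 * (a * LZ) := by
    have := hZ₁ Z hZZ₁ (Z ^ 8) le_rfl (Nat.pow_le_pow_right (by omega) (by norm_num))
    push_cast at this
    exact this
  have hD : X * ρ ≤ 256 * (d * LY) := hY₁ Y hYY₁
  have hLYK : LY ≤ 256 * K := by
    have h1 : (Y : ℝ) ≤ 2 ^ (Z + 1) ^ 8 := by exact_mod_cast hYu.le
    have h2 := Real.log_le_log (by linarith) h1
    rw [Real.log_pow] at h2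
    have h3 : ((Z + 1 : ℕ) : ℝ) ^ 8 ≤ (2 * Z : ℝ) ^ 8 := by
      push_cast
      gcongr
      linarith
    have h4 := Real.log_two_lt_d9
    push_cast at h2 h3
    calc LY ≤ ((Z : ℝ) + 1) ^ 8 * Real.log 2 := h2
      _ ≤ (2 * Z : ℝ) ^ 8 * 1 := by gcongr; linarith
      _ = 256 * K := by rw [hK]; ring
  have hρZ : LZ ≤ ρ := by
    have h1 := log_log_le_sum_inv_primes hY2
    have h2 : (2 : ℝ) ^ Z ^ 8 ≤ Y := by exact_mod_cast hYl
    have h3 := Real.log_le_log (by positivity) h2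
    rw [Real.log_pow] at h3
    have hl2 : 0 < Real.log 2 := Real.log_pos (by norm_num)
    have h4 := Real.log_le_log (by positivity) h3
    rw [Real.log_mul (by positivity) hl2.ne'] at h4
    push_cast at h4
    rw [Real.log_pow] at h4
    have h5 : -1 ≤ Real.log (Real.log 2) := by
      have := Real.one_sub_inv_le_log_of_pos hl2
      have h6 : (Real.log 2)⁻¹ ≤ 2 := by
        rw [inv_le_comm₀ hl2 two_pos]
        have := Real.log_two_gt_d9
        norm_num
        linarith
      linarith
    have h7 : (0.69 : ℝ) ≤ LZ := by
      have := Real.log_le_log two_pos hZr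
      have := Real.log_two_gt_d9
      linarith
    rw [hρ, primeRecipSum]
    push_cast at h4
    linarith
  have hρ0 : 0 < ρ := hLZ0.trans_le hρZ
  set M : ℝ := a * d with hM
  have ha0 : 0 < a := by
    by_contra! h
    nlinarith
  have hd0 : 0 < d := by
    by_contra! h
    nlinarith [mul_pos hX0 hρ0]
  have hM0 : 0 < M := mul_pos ha0 hd0
  have hML : K * (X * ρ) ≤ 2 ^ 14 * (M * (LZ * LY)) := by
    have := mul_le_mul hA hD (by positivity) (by positivity)
    rw [hM]
    linarith
  have hMX : X ≤ 2 ^ 22 * M := by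
    have h1 : X * (LZ * LY) ≤ 2 ^ 22 * M * (LZ * LY) := by
      calc X * (LZ * LY) ≤ X * (ρ * (256 * K)) := by gcongr
        _ = 256 * (K * (X * ρ)) := by ring
        _ ≤ 256 * (2 ^ 14 * (M * (LZ * LY))) := by gcongr
        _ = _ := by ring
    exact le_of_mul_le_mul_right h1 (by positivity)
  set W : ℝ := ((∑ m ∈ Icc 1 (Z ^ 8), ∑ p ∈ gapSet Z m,
      (shiftedPairs Y (2 ^ p * (2 ^ m - 1))).card : ℕ) : ℝ) with hW
  have hWX : W * X ≤ C * 2 ^ 28 * M ^ 2 := by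
    have h1 := hC Z Y (by omega) hY2
    have h2 : W * X * (LY ^ 2 * LZ ^ 2) ≤ C * 2 ^ 28 * M ^ 2 * (LY ^ 2 * LZ ^ 2) := by
      calc W * X * (LY ^ 2 * LZ ^ 2) = W * (LY ^ 2 * LZ ^ 2) * X := by ring
        _ ≤ C * (K ^ 2 * ρ ^ 2 * X) * X := by gcongr
        _ = C * (K * (X * ρ)) ^ 2 := by ring
        _ ≤ C * (2 ^ 14 * (M * (LZ * LY))) ^ 2 := by gcongr
        _ = _ := by ring
    exact le_of_mul_le_mul_right h2 (by positivity)
  have hE : ((triples Z Y).card : ℝ) = M := by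
    rw [triples, card_product, Nat.cast_mul]
  have hcoin : (((triples Z Y ×ˢ triples Z Y).filter fun e =>
      tripleSum e.1 = tripleSum e.2).card : ℝ) ≤ M + 2 * W := by
    rw [← hE, hW]
    exact_mod_cast card_coincidences_le Z Y
  have hCS : M ^ 2 ≤ ((triples Z Y).image tripleSum).card * (M + 2 * W) := by
    refine le_trans ?_ (mul_le_mul_of_nonneg_left hcoin (Nat.cast_nonneg _))
    rw [← hE]
    exact_mod_cast card_sq_le_card_image_mul (triples Z Y) tripleSum
  have hI : (((triples Z Y).image tripleSum).card : ℝ) ≤ (sumset (Y ^ 16)).card := by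
    exact_mod_cast card_le_card (image_tripleSum_subset hYl)
  set I : ℝ := (((triples Z Y).image tripleSum).card : ℝ)
  have hI0 : 0 ≤ I := Nat.cast_nonneg _
  refine le_trans ?_ hI
  rw [inv_mul_le_iff₀ (by positivity)]
  have h1 : X * (M + 2 * W) ≤ (2 ^ 22 + 2 ^ 29 * C) * M ^ 2 := by
    nlinarith [mul_le_mul_of_nonneg_right hMX hM0.le]
  have h2 : X * M ^ 2 ≤ ((2 ^ 22 + 2 ^ 29 * C) * I) * M ^ 2 := by
    calc X * M ^ 2 ≤ X * (I * (M + 2 * W)) := by gcongr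
      _ = I * (X * (M + 2 * W)) := by ring
      _ ≤ I * ((2 ^ 22 + 2 ^ 29 * C) * M ^ 2) := by gcongr
      _ = _ := by ring
  exact le_of_mul_le_mul_right h2 (by positivity)

lemma exists_between_of_strictMono {f : ℕ → ℕ} (hf : StrictMono f) {n : ℕ} (h : f 0 ≤ n) :
    ∃ k, f k ≤ n ∧ n < f (k + 1) := by
  have hex : ∃ k, n < f k := ⟨n + 1, (Nat.lt_succ_self n).trans_le hf.le_apply⟩
  obtain ⟨k, hk⟩ : ∃ k, Nat.find hex = k + 1 := Nat.exists_eq_succ_of_ne_zero fun h0 => by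
    have := Nat.find_spec hex
    rw [h0] at this
    omega
  refine ⟨k, ?_, hk ▸ Nat.find_spec hex⟩
  have := Nat.find_min hex (m := k) (by omega)
  omega

theorem exists_card_sumset_ge :
    ∃ c : ℝ, 0 < c ∧ ∃ N₀ : ℕ, ∀ N ≥ N₀, c * ((N : ℝ) + 1) ≤ (sumset N).card := by
  obtain ⟨c, hc0, Z₀, h⟩ := exists_card_sumset_pow_ge
  refine ⟨c / 2 ^ 16, by positivity, (2 ^ (Z₀ + 1) ^ 8) ^ 16, fun N hN => ?_⟩
  obtain ⟨Y, hYl, hYu⟩ := exists_between_of_strictMono (f := fun k => k ^ 16)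
    (Nat.pow_left_strictMono (by norm_num)) (n := N) (by simp)
  have hYZ : 2 ^ (Z₀ + 1) ^ 8 ≤ Y :=
    Nat.lt_succ_iff.1 (lt_of_pow_lt_pow_left₀ 16 (by omega) (hN.trans_lt hYu))
  have hY1 : 2 ≤ Y := le_trans (Nat.le_self_pow (by positivity) 2) hYZ
  have hmono : StrictMono fun k : ℕ => 2 ^ k ^ 8 := fun i j hij =>
    Nat.pow_lt_pow_right (by norm_num) (Nat.pow_lt_pow_left hij (by norm_num))
  obtain ⟨Z, hZl, hZu⟩ := exists_between_of_strictMono hmono (n := Y) (by simp; omega)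
  have hZ : Z₀ ≤ Z := by
    have := hmono.lt_iff_lt.1 (hYZ.trans_lt hZu)
    omega
  have hmain := h Z hZ Y hZl hZu
  have hsub : (sumset (Y ^ 16)).card ≤ (sumset N).card := by
    refine card_le_card fun n hn => ?_
    rw [sumset, mem_filter, mem_Icc] at hn ⊢
    exact ⟨⟨hn.1.1, hn.1.2.trans hYl⟩, hn.2⟩
  have hN' : (N : ℝ) + 1 ≤ 2 ^ 16 * (Y : ℝ) ^ 16 := by
    have : N + 1 ≤ 2 ^ 16 * Y ^ 16 := by
      rw [← mul_pow]
      exact hYu.trans_le (Nat.pow_le_pow_left (by omega) 16)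
    exact_mod_cast this
  calc c / 2 ^ 16 * ((N : ℝ) + 1) ≤ c / 2 ^ 16 * (2 ^ 16 * (Y : ℝ) ^ 16) := by gcongr
    _ = c * (Y : ℝ) ^ 16 := by field_simp
    _ ≤ _ := hmain.trans (by exact_mod_cast hsub)

end RomanovP2

/-- The sumset `2^𝒫 + P₂ = {2^p + q : p prime, q ∈ P₂}` has positive lower
asymptotic density. -/
theorem romanov_P2 : ∃ c : ℝ, 0 < c ∧ ∃ x₀ : ℝ, ∀ x : ℝ, x₀ ≤ x →
    c * x ≤ (((Finset.Icc 1 ⌊x⌋₊).filter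
      (fun n => ∃ p q : ℕ, p.Prime ∧ P2 q ∧ n = 2 ^ p + q)).card : ℝ) := by
  obtain ⟨c, hc0, N₀, h⟩ := RomanovP2.exists_card_sumset_ge
  refine ⟨c, hc0, N₀, fun x hx => ?_⟩
  have h1 := h ⌊x⌋₊ (Nat.le_floor hx)
  refine (mul_le_mul_of_nonneg_left (Nat.lt_floor_add_one x).le hc0.le).trans ?_
  exact h1
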